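/- arXiv:1610.09304 — 8 statements merged into one kernel-verified Lean document; each statement's English description precedes it below -/
import Mathlib

section
/- For every finite R-module M, one has dim_{F_R} Tor_1^R(M, F_R) ≥ dim_{F_R}(M ⊗_R F_R); that is, d_M ≥ 0. -/
/- STATEMENT 0: For every finite R-module M, one has
   dim_{F_R} Tor_1^R(M, F_R) ≥ dim_{F_R}(M ⊗_R F_R); that is, d_M ≥ 0.

   Here R is a commutative local ring containing ℤ_p, finitely generated as a
   ℤ_p-module, with finite residue field F_R.  Since the modules in question are
   finite-dimensional F_R-vector spaces, their F_R-dimension equals the base-|F_R|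
   logarithm of their cardinality, which is how we express it. -/

open IsLocalRing CategoryTheory

/-- `Tor_1^R(M, N)` (as an object of `ModuleCat R`), defined by left-deriving the
tensor product. -/
noncomputable def tor1 (R : Type) [CommRing R] (M : Type) [AddCommGroup M] [Module R M]
    (N : Type) [AddCommGroup N] [Module R N] : ModuleCat R :=
  ((Tor (ModuleCat R) 1).obj (ModuleCat.of R M)).obj (ModuleCat.of R N)

/-- The dimension over the residue field `F_R` of a finite module `X` which is an
`F_R`-vector space: the base-`|F_R|` logarithm of its cardinality. -/
noncomputable def resDim (R : Type) [CommRing R] [IsLocalRing R] (X : Type) : ℕ :=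
  Nat.log (Nat.card (ResidueField R)) (Nat.card X)

section Aux
open MonoidalCategory

lemma aux_homologyMap {R : Type} [CommRing R] {A B : ModuleCat.{0} R} (f : A ⟶ B)
    (N : ModuleCat.{0} R) (P : ProjectiveResolution N) (h : f ▷ N = 0) :
    HomologicalComplex.homologyMap
      ((NatTrans.mapHomologicalComplex ((tensoringLeft (ModuleCat.{0} R)).map f) _).app P.complex) 0 = 0 := by
  have : Limits.PreservesFiniteColimits ((tensoringLeft (ModuleCat.{0} R)).obj B) :=
    inferInstanceAs (Limits.PreservesFiniteColimits (tensorLeft B))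
  have key : HomologicalComplex.opcyclesMap
      ((NatTrans.mapHomologicalComplex ((tensoringLeft (ModuleCat.{0} R)).map f) _).app P.complex) 0 = 0 := by
    rw [← cancel_mono (P.fromLeftDerivedZero' ((tensoringLeft (ModuleCat.{0} R)).obj B)),
      ← cancel_epi (HomologicalComplex.pOpcycles _ _)]
    rw [HomologicalComplex.p_opcyclesMap_assoc, 
      ProjectiveResolution.pOpcycles_comp_fromLeftDerivedZero']
    have := ((tensoringLeft (ModuleCat.{0} R)).map f).naturality (P.π.f 0)
    refine this.symm.trans ?_
    change _ ≫ f ▷ N = _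
    rw [h]; simp; rfl
  rw [← cancel_mono (HomologicalComplex.homologyι _ _),
    HomologicalComplex.homologyι_naturality, key]; simp

lemma aux_tor {R : Type} [CommRing R] (S : ShortComplex (ModuleCat.{0} R)) (hS : S.ShortExact)
    [Module.Flat R S.X₂] (N : ModuleCat.{0} R) (h : S.f ▷ N = 0) :
    Nonempty (((Tor (ModuleCat.{0} R) 1).obj S.X₃).obj N ≅ S.X₁ ⊗ N) := by
  let P := projectiveResolution N
  have (A : ModuleCat.{0} R) : Limits.PreservesFiniteColimits ((tensoringLeft (ModuleCat.{0} R)).obj A) :=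
    inferInstanceAs (Limits.PreservesFiniteColimits (tensorLeft A))
  have : Limits.PreservesFiniteLimits ((tensoringLeft (ModuleCat.{0} R)).obj S.X₂) :=
    inferInstanceAs (Limits.PreservesFiniteLimits (tensorLeft S.X₂))
  let T : ShortComplex (ChainComplex (ModuleCat.{0} R) ℕ) :=
    { X₁ := (((tensoringLeft (ModuleCat.{0} R)).obj S.X₁).mapHomologicalComplex _).obj P.complex
      X₂ := (((tensoringLeft (ModuleCat.{0} R)).obj S.X₂).mapHomologicalComplex _).obj P.complex
      X₃ := (((tensoringLeft (ModuleCat.{0} R)).obj S.X₃).mapHomologicalComplex _).obj P.complex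
      f := (NatTrans.mapHomologicalComplex ((tensoringLeft (ModuleCat.{0} R)).map S.f) _).app P.complex
      g := (NatTrans.mapHomologicalComplex ((tensoringLeft (ModuleCat.{0} R)).map S.g) _).app P.complex
      zero := by
        ext i : 1
        change S.f ▷ _ ≫ S.g ▷ _ = 0
        rw [← comp_whiskerRight, S.zero]; simp }
  have hT : T.ShortExact := by
    apply HomologicalComplex.shortExact_of_degreewise_shortExact
    intro i
    have : Module.Projective R (P.complex.X i) := 
      (IsProjective.iff_projective _ ).2 (P.projective i)
    have : Module.Flat R (P.complex.X i) := inferInstance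
    exact hS.map_of_exact (tensorRight (P.complex.X i))
  have hz : Limits.IsZero (T.X₂.homology 1) := by
    rw [← HomologicalComplex.exactAt_iff_isZero_homology]
    have := P.complex_exactAt_succ 0
    exact ShortComplex.Exact.map this ((tensoringLeft (ModuleCat.{0} R)).obj S.X₂)
  have hm : Mono (hT.δ 1 0 rfl) := hT.mono_δ 1 0 rfl hz
  have he : Epi (hT.δ 1 0 rfl) := by
    have := hT.homology_exact₁ 1 0 rfl
    exact this.epi_f (aux_homologyMap S.f N P h)
  have hiso : IsIso (hT.δ 1 0 rfl) := isIso_of_mono_of_epi _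
  exact ⟨P.isoLeftDerivedObj ((tensoringLeft (ModuleCat.{0} R)).obj S.X₃) 1 ≪≫
    (@asIso _ _ _ _ (hT.δ 1 0 rfl) hiso) ≪≫ (P.isoLeftDerivedObj ((tensoringLeft (ModuleCat.{0} R)).obj S.X₁) 0).symm ≪≫
    (Functor.leftDerivedZeroIsoSelf _).app N⟩

open TensorProduct in
lemma aux_card {R : Type} [CommRing R] [IsLocalRing R] (N : Type) [AddCommGroup N] [Module R N]
    [Module.Finite R N] : Nat.card (N ⊗[R] ResidueField R) =
      Nat.card (ResidueField R) ^ Module.finrank (ResidueField R) (ResidueField R ⊗[R] N) := by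
  rw [Nat.card_congr (TensorProduct.comm R N (ResidueField R)).toEquiv,
    Module.natCard_eq_pow_finrank (K := ResidueField R)]

open TensorProduct in
lemma aux_surj {R : Type} [CommRing R] [IsLocalRing R] (N : Type) [AddCommGroup N] [Module R N]
    [Module.Finite R N] : ∃ f : (Fin (Module.finrank (ResidueField R) (ResidueField R ⊗[R] N)) → R) →ₗ[R] N,
      Function.Surjective f := by
  let b := Module.finBasis (ResidueField R) (ResidueField R ⊗[R] N)
  choose v hv using fun i => TensorProduct.mk_surjective R N (ResidueField R)
    Ideal.Quotient.mk_surjective (b i)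
  have := IsLocalRing.span_eq_top_of_tmul_eq_basis v b hv
  refine ⟨Fintype.linearCombination R v, ?_⟩
  rw [← LinearMap.range_eq_top, Fintype.range_linearCombination, this]

lemma aux_rank (p : ℕ) [Fact p.Prime] (R : Type) [CommRing R] 
    [Algebra ℤ_[p] R] (hinj : Function.Injective (algebraMap ℤ_[p] R))
    [Module.Finite ℤ_[p] R] (d r : ℕ) (K : Submodule R (Fin d → R)) 
    [Finite ((Fin d → R) ⧸ K)] (f : (Fin r → R) →ₗ[R] K) (hf : Function.Surjective f) : d ≤ r := by
  have : Module.Finite R K := Module.Finite.of_surjective f hf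
  have : Module.Finite ℤ_[p] K := Module.Finite.trans R K
  have h1 := (K.restrictScalars ℤ_[p]).finrank_quotient_add_finrank
  have hfin : Finite ((Fin d → R) ⧸ K.restrictScalars ℤ_[p]) := ‹Finite ((Fin d → R) ⧸ K)›
  have h0 : Module.finrank ℤ_[p] ((Fin d → R) ⧸ K.restrictScalars ℤ_[p]) = 0 := by
    rw [Module.finrank_eq_zero_iff]
    intro x
    refine ⟨(Nat.card ((Fin d → R) ⧸ K.restrictScalars ℤ_[p]) : ℤ_[p]), ?_, ?_⟩
    · exact_mod_cast Nat.card_pos.ne'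
    · rw [Nat.cast_smul_eq_nsmul]
      exact card_nsmul_eq_zero'
  have h2 : Module.finrank ℤ_[p] K ≤ Module.finrank ℤ_[p] (Fin r → R) := by
    have := LinearMap.finrank_range_le (f.restrictScalars ℤ_[p])
    rwa [LinearMap.range_eq_top.2 (by exact hf), finrank_top] at this
  have hd (n : ℕ) : Module.finrank ℤ_[p] (Fin n → R) = n * Module.finrank ℤ_[p] R := by
    induction n with
    | zero => simp [Module.finrank_zero_of_subsingleton]
    | succ n ih =>
      let e := Fin.consLinearEquiv ℤ_[p] (fun _ : Fin (n + 1) => R)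
      have e1 : Module.finrank ℤ_[p] (R × (Fin n → R)) = Module.finrank ℤ_[p] (Fin (n + 1) → R) :=
        e.finrank_eq
      have h := (LinearMap.ker (LinearMap.fst ℤ_[p] R (Fin n → R))).finrank_quotient_add_finrank
      rw [(LinearMap.quotKerEquivRange _).finrank_eq] at h
      rw [LinearMap.ker_fst, LinearMap.range_eq_top.2 LinearMap.fst_surjective, finrank_top,
        LinearMap.finrank_range_of_inj LinearMap.inr_injective, ih, e1] at h
      rw [← h]; ring
  have he : 0 < Module.finrank ℤ_[p] R := by
    rw [Nat.pos_iff_ne_zero, Ne, Module.finrank_eq_zero_iff]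
    intro h
    obtain ⟨a, ha, h⟩ := h 1
    rw [Algebra.smul_def, mul_one] at h
    exact ha (hinj (by simpa using h))
  have h3 : Module.finrank ℤ_[p] (K.restrictScalars ℤ_[p]) = Module.finrank ℤ_[p] K := rfl
  rw [h0, zero_add, h3, hd] at h1
  rw [h1, hd] at h2
  exact Nat.le_of_mul_le_mul_right h2 he

end Aux

theorem statement0 (p : ℕ) [Fact p.Prime] (R : Type) [CommRing R] [IsLocalRing R]
    [Algebra ℤ_[p] R] (hinj : Function.Injective (algebraMap ℤ_[p] R))
    [Module.Finite ℤ_[p] R] [Finite (ResidueField R)]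
    (M : Type) [AddCommGroup M] [Module R M] [Finite M] :
    resDim R (TensorProduct R M (ResidueField R)) ≤ resDim R (tor1 R M (ResidueField R)) := by
  have : IsNoetherianRing R := isNoetherian_of_tower ℤ_[p] (isNoetherian_of_isNoetherianRing_of_finite ℤ_[p] R)
  have : Module.Finite R M := Module.Finite.of_finite
  obtain ⟨d, hd, f, hf⟩ : ∃ d : ℕ,
      d = Module.finrank (ResidueField R) (TensorProduct R (ResidueField R) M) ∧
      ∃ f : (Fin d → R) →ₗ[R] M, Function.Surjective f := ⟨_, rfl, aux_surj (R := R) M⟩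
  let K := LinearMap.ker f
  let S : ShortComplex (ModuleCat.{0} R) :=
    ShortComplex.mk (ModuleCat.ofHom K.subtype) (ModuleCat.ofHom f) (by ext x; exact x.2)
  have hS : S.ShortExact := by
    refine ShortComplex.ShortExact.mk' ?_ ?_ ?_
    · rw [ShortComplex.ShortExact.moduleCat_exact_iff_function_exact]
      exact LinearMap.exact_subtype_ker_map f
    · rw [ModuleCat.mono_iff_injective]; exact K.subtype_injective
    · rw [ModuleCat.epi_iff_surjective]; exact hf
  have : Module.Flat R S.X₂ := inferInstanceAs (Module.Flat R (Fin d → R))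
  have hbij : Function.Injective (f.rTensor (ResidueField R)) := by
    have hs := LinearMap.rTensor_surjective (ResidueField R) hf
    have hc : Nat.card (TensorProduct R (Fin d → R) (ResidueField R)) =
        Nat.card (TensorProduct R M (ResidueField R)) := by
      rw [aux_card, aux_card, ← hd, Module.finrank_baseChange, Module.finrank_fin_fun]
    have : Finite (TensorProduct R (Fin d → R) (ResidueField R)) := by
      apply Nat.finite_of_card_ne_zero
      rw [aux_card]
      exact pow_ne_zero _ Nat.card_pos.ne'
    exact ((Nat.bijective_iff_surjective_and_card _).2 ⟨hs, hc⟩).1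
  have h0 : K.subtype.rTensor (ResidueField R) = 0 := by
    ext x y
    apply hbij
    simp [K]
  obtain ⟨e⟩ := aux_tor S hS (ModuleCat.of R (ResidueField R)) (by
    apply ModuleCat.hom_ext
    exact h0)
  have hc : Nat.card (tor1 R M (ResidueField R)) = Nat.card (TensorProduct R K (ResidueField R)) :=
    Nat.card_congr e.toLinearEquiv.toEquiv
  obtain ⟨g, hg⟩ := aux_surj (R := R) K
  have : Finite ((Fin d → R) ⧸ K) := Finite.of_equiv _ (f.quotKerEquivOfSurjective hf).toEquiv.symm
  have hle := aux_rank p R hinj d _ K g hg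
  replace hle := hd.symm.le.trans hle
  unfold resDim
  apply Nat.log_mono_right
  rw [hc, aux_card, aux_card]
  exact Nat.pow_le_pow_right Nat.card_pos hle
end

section
/- A finite R-module M occurs as a cokernel (i.e., M ≅ coker(G) for some N ≥ 1 and some R-linear endomorphism G of R^N) if and only if d_M = 0. -/
/- STATEMENT 1: A finite R-module M occurs as a cokernel (i.e., M ≅ coker(G) for some
   N ≥ 1 and some R-linear endomorphism G of R^N) if and only if d_M = 0, i.e. iff
   dim_{F_R} Tor_1^R(M, F_R) = dim_{F_R}(M ⊗_R F_R). -/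

open IsLocalRing CategoryTheory

/-- `M` occurs as the cokernel of an `R`-linear endomorphism of `R^N` for some `N ≥ 1`. -/
def OccursAsCokernel (R M : Type) [CommRing R] [AddCommGroup M] [Module R M] : Prop :=
  ∃ N : ℕ, 0 < N ∧ ∃ G : (Fin N → R) →ₗ[R] (Fin N → R),
    Nonempty (((Fin N → R) ⧸ LinearMap.range G) ≃ₗ[R] M)

open TensorProduct in
theorem aux_snake {R : Type} [CommRing R] {K L M A P F : Type}
    [AddCommGroup K] [Module R K] [AddCommGroup L] [Module R L] [AddCommGroup M] [Module R M]
    [AddCommGroup A] [Module R A] [AddCommGroup P] [Module R P] [AddCommGroup F] [Module R F]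
    (i : K →ₗ[R] L) (g : L →ₗ[R] M) (hi : Function.Injective i) (hig : Function.Exact i g)
    (hg : Function.Surjective g)
    (j : A →ₗ[R] P) (e : P →ₗ[R] F) (hj : Function.Injective j) (hje : Function.Exact j e)
    (he : Function.Surjective e) [Module.Flat R L] [Module.Flat R P] :
    Nat.card (LinearMap.ker (j.lTensor M)) = Nat.card (LinearMap.ker (i.lTensor F)) := by
  have h1 : (i.rTensor P).comp (j.lTensor K) = (j.lTensor L).comp (i.rTensor A) := by
    ext; simp
  have h2 : (g.rTensor P).comp (j.lTensor L) = (j.lTensor M).comp (g.rTensor A) := by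
    ext; simp
  have hf2 := LinearMap.rTensor_surjective A hg
  have hg1 := Module.Flat.rTensor_preserves_injective_linearMap (M := P) i hi
  have hinj := Module.Flat.lTensor_preserves_injective_linearMap (M := L) j hj
  have hi2 : Function.Exact (0 : Unit →ₗ[R] L ⊗[R] A) (j.lTensor L) := by
    rw [LinearMap.exact_iff, LinearMap.range_zero]
    exact LinearMap.ker_eq_bot.mpr hinj
  have hi3 : Function.Exact (LinearMap.ker (j.lTensor M)).subtype (j.lTensor M) := by
    rw [LinearMap.exact_iff, Submodule.range_subtype]
  have hp1 := lTensor_exact K hje he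
  have hp2 := lTensor_exact L hje he
  let δ := SnakeLemma.δ' (j.lTensor K) (j.lTensor L) (j.lTensor M) (i.rTensor A) (g.rTensor A)
    (rTensor_exact A hig hg) (i.rTensor P) (g.rTensor P) (rTensor_exact P hig hg) h1 h2
    (LinearMap.ker (j.lTensor M)).subtype hi3 (e.lTensor K) hp1 hf2 hg1
  have hr : Function.Exact (0 : Unit →ₗ[R] _) δ :=
    SnakeLemma.exact_δ'_right (ι₂ := 0) (hι₂ := hi2) _ _ _ _ _ _ _ _ _ _ _ _ _ _ _ _ _ _
      (by simp) (Submodule.subtype_injective _)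
  have hl : Function.Exact δ (i.rTensor F) :=
    SnakeLemma.exact_δ'_left (π₂ := e.lTensor L) (hπ₂ := hp2) _ _ _ _ _ _ _ _ _ _ _ _ _ _ _ _ _ _
      (by ext; simp) (LinearMap.lTensor_surjective _ he)
  have hδ : Function.Injective δ := by
    rw [← LinearMap.ker_eq_bot, hr.linearMap_ker_eq, LinearMap.range_zero]
  rw [Nat.card_congr (LinearEquiv.ofInjective δ hδ).toEquiv, ← hl.linearMap_ker_eq]
  refine Nat.card_congr ((TensorProduct.comm R K F).toEquiv.subtypeEquiv fun x => ?_)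
  have : i.lTensor F (TensorProduct.comm R K F x) = TensorProduct.comm R L F (i.rTensor F x) := by
    exact LinearMap.congr_fun (by ext; simp :
      (i.lTensor F).comp (TensorProduct.comm R K F).toLinearMap =
        (TensorProduct.comm R L F).toLinearMap.comp (i.rTensor F)) x
  simp [this]

theorem aux_hom {R : Type} [CommRing R] {A B C Q : Type}
    [AddCommGroup A] [Module R A] [AddCommGroup B] [Module R B] [AddCommGroup C] [Module R C]
    [AddCommGroup Q] [Module R Q]
    (f : A →ₗ[R] B) (h : B →ₗ[R] C) (q : B →ₗ[R] Q) (j : Q →ₗ[R] C)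
    (hq : Function.Surjective q) (hfq : Function.Exact f q) (hh : h = j.comp q)
    (hf : ∀ x, f x ∈ LinearMap.ker h) :
    Nat.card (LinearMap.ker h ⧸ LinearMap.range (f.codRestrict _ hf)) =
      Nat.card (LinearMap.ker j) := by
  let r : LinearMap.ker h →ₗ[R] LinearMap.ker j := q.restrict (by
    intro x hx; subst hh; simpa using hx)
  have hr : Function.Surjective r := by
    rintro ⟨y, hy⟩
    obtain ⟨x, rfl⟩ := hq y
    exact ⟨⟨x, by subst hh; simpa using hy⟩, rfl⟩
  have hk : LinearMap.range (f.codRestrict _ hf) = LinearMap.ker r := by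
    ext ⟨x, hx⟩
    have := hfq x
    simp only [LinearMap.mem_range, LinearMap.mem_ker, r, Subtype.ext_iff,
      LinearMap.codRestrict_apply, LinearMap.restrict_apply]
    exact this.symm
  rw [hk]
  exact Nat.card_congr (r.quotKerEquivOfSurjective hr).toEquiv

theorem aux_tor_s1 {R : Type} [CommRing R] {K L M F : Type}
    [AddCommGroup K] [Module R K] [AddCommGroup L] [Module R L] [AddCommGroup M] [Module R M]
    [AddCommGroup F] [Module R F]
    (i : K →ₗ[R] L) (g : L →ₗ[R] M) (hi : Function.Injective i) (hig : Function.Exact i g)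
    (hg : Function.Surjective g) [Module.Flat R L] :
    Nat.card (tor1 R M F) = Nat.card (LinearMap.ker (i.lTensor F)) := by
  let P := projectiveResolution (ModuleCat.of R F)
  let T := (MonoidalCategory.tensoringLeft (ModuleCat R)).obj (ModuleCat.of R M)
  let S : ShortComplex (ModuleCat R) := ((T.mapHomologicalComplex _).obj P.complex).sc' 2 1 0
  let I : tor1 R M F ≅ S.moduleCatLeftHomologyData.H :=
    P.isoLeftDerivedObj T 1 ≪≫
      ShortComplex.homologyMapIso
        (((T.mapHomologicalComplex _).obj P.complex).isoSc' 2 1 0 (by simp) (by simp)) ≪≫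
      S.moduleCatHomologyIso
  rw [Nat.card_congr I.toLinearEquiv.toEquiv]
  let d1 : P.complex.X 1 →ₗ[R] P.complex.X 0 := (P.complex.d 1 0).hom
  let d2 : P.complex.X 2 →ₗ[R] P.complex.X 1 := (P.complex.d 2 1).hom
  let ε : P.complex.X 0 →ₗ[R] F := (P.π.f 0).hom
  have e21 : Function.Exact d2 d1 :=
    (ShortComplex.ShortExact.moduleCat_exact_iff_function_exact _).mp (P.exact_succ 0)
  have e1 : Function.Exact d1 ε :=
    (ShortComplex.ShortExact.moduleCat_exact_iff_function_exact _).mp P.exact₀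
  have hε : Function.Surjective ε :=
    (ModuleCat.epi_iff_surjective (P.π.f 0)).mp inferInstance
  have : Module.Projective R (P.complex.X 0) :=
    (IsProjective.iff_projective _).mpr (P.projective 0)
  have e1' : Function.Exact (LinearMap.range d1).subtype ε := by
    rw [LinearMap.exact_iff, Submodule.range_subtype, e1.linearMap_ker_eq]
  have e2' : Function.Exact d2 d1.rangeRestrict := by
    rw [LinearMap.exact_iff, LinearMap.ker_rangeRestrict, e21.linearMap_ker_eq]
  rw [← aux_snake i g hi hig hg (LinearMap.range d1).subtype ε (Submodule.subtype_injective _)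
    e1' hε]
  refine aux_hom (d2.lTensor M) (d1.lTensor M) (d1.rangeRestrict.lTensor M)
    ((LinearMap.range d1).subtype.lTensor M)
    (LinearMap.lTensor_surjective _ d1.surjective_rangeRestrict)
    (lTensor_exact M e2' d1.surjective_rangeRestrict) ?_ ?_
  · rw [← LinearMap.lTensor_comp]; rfl

open TensorProduct in
theorem aux_gen {R : Type} [CommRing R] [IsLocalRing R] {K : Type} [AddCommGroup K] [Module R K]
    [Module.Finite R K] {k : ℕ} (hk : Module.finrank (ResidueField R) (ResidueField R ⊗[R] K) = k) :
    ∃ f : (Fin k → R) →ₗ[R] K, Function.Surjective f := by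
  let b := Module.finBasisOfFinrankEq _ _ hk
  obtain ⟨v, hv⟩ := (TensorProduct.mk_surjective R K (ResidueField R)
    Ideal.Quotient.mk_surjective).comp_left b
  refine ⟨Fintype.linearCombination R v, ?_⟩
  rw [← LinearMap.range_eq_top, Fintype.range_linearCombination]
  exact span_eq_top_of_tmul_eq_basis v b fun i => congrFun hv i

open TensorProduct in
theorem aux_dim {R : Type} [CommRing R] [IsLocalRing R] [IsNoetherianRing R]
    [Finite (ResidueField R)] {M : Type} [AddCommGroup M] [Module R M] {n : ℕ}
    (g : (Fin n → R) →ₗ[R] M) (hg : Function.Surjective g) :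
    resDim R (tor1 R M (ResidueField R)) + n =
      Module.finrank (ResidueField R) (ResidueField R ⊗[R] LinearMap.ker g) +
        resDim R (M ⊗[R] ResidueField R) := by
  have hM : Module.Finite R M := Module.Finite.of_surjective g hg
  have hq : 1 < Nat.card (ResidueField R) := Finite.one_lt_card
  let i := (LinearMap.ker g).subtype
  have hig : Function.Exact i g := by
    rw [LinearMap.exact_iff, Submodule.range_subtype]
  let iF := i.baseChange (ResidueField R)
  let gF := g.baseChange (ResidueField R)
  have hgF : Function.Surjective gF := LinearMap.lTensor_surjective _ hg
  have hex : LinearMap.ker gF = LinearMap.range iF := by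
    ext x; exact lTensor_exact (ResidueField R) hig hg x
  have h1 : resDim R (tor1 R M (ResidueField R)) =
      Module.finrank (ResidueField R) (LinearMap.ker iF) := by
    rw [resDim, aux_tor_s1 i g (Submodule.subtype_injective _) hig hg]
    have : Nat.card (LinearMap.ker (i.lTensor (ResidueField R))) =
      Nat.card (LinearMap.ker iF) := rfl
    rw [this, Module.natCard_eq_pow_finrank (K := ResidueField R) (V := LinearMap.ker iF),
      Nat.log_pow hq]
  have h2 : resDim R (M ⊗[R] ResidueField R) =
      Module.finrank (ResidueField R) (ResidueField R ⊗[R] M) := by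
    rw [resDim, Nat.card_congr (TensorProduct.comm R M (ResidueField R)).toEquiv,
      Module.natCard_eq_pow_finrank (K := ResidueField R) (V := ResidueField R ⊗[R] M),
      Nat.log_pow hq]
  have h3 := LinearMap.finrank_range_add_finrank_ker iF
  have h4 := LinearMap.finrank_range_add_finrank_ker gF
  rw [LinearMap.range_eq_top.mpr hgF, finrank_top, hex,
    Module.finrank_baseChange (M' := Fin n → R),
    Module.finrank_fin_fun] at h4
  omega

open TensorProduct in
theorem aux_rank_s1 {R : Type} [CommRing R] {M : Type} [AddCommGroup M] [Module R M] {k n : ℕ}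
    (f : (Fin k → R) →ₗ[R] (Fin n → R)) (g : (Fin n → R) →ₗ[R] M) (hg : Function.Surjective g)
    (hfg : Function.Exact f g) (c : R) (hc : ¬ IsNilpotent c) (hcM : ∀ m : M, c • m = 0) :
    n ≤ k := by
  let S := Localization.Away c
  have : Nontrivial S := by
    by_contra h
    rw [not_nontrivial_iff_subsingleton, IsLocalization.subsingleton_iff (M := Submonoid.powers c)] at h
    exact hc h
  have : Nontrivial R := (algebraMap R S).domain_nontrivial
  have hu : IsUnit (algebraMap R S c) := IsLocalization.Away.algebraMap_isUnit c
  have hz : ∀ x : S ⊗[R] M, x = 0 := by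
    intro x
    have : algebraMap R S c • x = 0 := by
      induction x with
      | zero => simp
      | tmul s m => rw [algebraMap_smul, ← TensorProduct.tmul_smul, hcM, TensorProduct.tmul_zero]
      | add x y hx hy => rw [smul_add, hx, hy, add_zero]
    exact (hu.smul_eq_zero).mp this
  have hs : Function.Surjective (f.baseChange S) := fun y =>
    (lTensor_exact S hfg hg y).mp (hz _)
  have := LinearMap.finrank_le_finrank_of_surjective hs
  simpa [Module.finrank_baseChange] using this

theorem statement1 (p : ℕ) [Fact p.Prime] (R : Type) [CommRing R] [IsLocalRing R]
    [Algebra ℤ_[p] R] (hinj : Function.Injective (algebraMap ℤ_[p] R))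
    [Module.Finite ℤ_[p] R] [Finite (ResidueField R)]
    (M : Type) [AddCommGroup M] [Module R M] [Finite M] :
    OccursAsCokernel R M ↔
      resDim R (tor1 R M (ResidueField R)) = resDim R (TensorProduct R M (ResidueField R)) := by
  have hN : IsNoetherianRing R := IsNoetherianRing.of_finite ℤ_[p] R
  constructor
  · rintro ⟨N, hN0, G, ⟨e⟩⟩
    let g : (Fin N → R) →ₗ[R] M := e.toLinearMap.comp (LinearMap.range G).mkQ
    have hg : Function.Surjective g :=
      e.surjective.comp (Submodule.mkQ_surjective _)
    have hk : LinearMap.ker g = LinearMap.range G := by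
      simp [g, LinearMap.ker_comp]
    have hd := aux_dim g hg
    have hle : Module.finrank (ResidueField R)
        (TensorProduct R (ResidueField R) (LinearMap.ker g)) ≤ N := by
      rw [hk]
      have := LinearMap.finrank_le_finrank_of_surjective
        (f := G.rangeRestrict.baseChange (ResidueField R))
        (LinearMap.lTensor_surjective _ G.surjective_rangeRestrict)
      simpa [Module.finrank_baseChange] using this
    obtain ⟨f, hf⟩ := aux_gen (R := R) (K := LinearMap.ker g) rfl
    have hge := aux_rank_s1 ((LinearMap.ker g).subtype.comp f) g hg
      (by
        rw [LinearMap.exact_iff, LinearMap.range_comp_of_range_eq_top _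
          (LinearMap.range_eq_top.mpr hf), Submodule.range_subtype])
      (Nat.card M : R)
      (by
        rintro ⟨m, hm⟩
        have : algebraMap ℤ_[p] R ((Nat.card M : ℤ_[p]) ^ m) = algebraMap ℤ_[p] R 0 := by
          simpa using hm
        have h0 := eq_zero_of_pow_eq_zero (hinj this)
        exact Nat.card_pos.ne' (Nat.cast_eq_zero.mp h0))
      (fun m => by rw [Nat.cast_smul_eq_nsmul, card_nsmul_eq_zero'])
    omega
  · intro h
    have : Module.Finite R M := inferInstance
    obtain ⟨n, g₀, hg₀⟩ := Module.Finite.exists_fin' R M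
    let g : (Fin (n + 1) → R) →ₗ[R] M := g₀.comp (LinearMap.funLeft R R Fin.castSucc)
    have hg : Function.Surjective g :=
      hg₀.comp (LinearMap.funLeft_surjective_of_injective _ _ _ (Fin.castSucc_injective n))
    have hd := aux_dim g hg
    obtain ⟨f, hf⟩ := aux_gen (R := R) (K := LinearMap.ker g) (k := n + 1) (by omega)
    refine ⟨n + 1, n.succ_pos, (LinearMap.ker g).subtype.comp f, ⟨?_⟩⟩
    refine (Submodule.quotEquivOfEq _ (LinearMap.ker g) ?_).trans (g.quotKerEquivOfSurjective hg)
    rw [LinearMap.range_comp_of_range_eq_top _ (LinearMap.range_eq_top.mpr hf),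
      Submodule.range_subtype]
end

section
/- Assume in addition that R is torsion-free as a Z_p-module. Then a finite R-module M occurs as a cokernel if and only if M has projective dimension at most 1 as an R-module (i.e., M admits a resolution 0 → P_1 → P_0 → M → 0 with P_0, P_1 projective). -/
/- STATEMENT 2: Assume in addition that R is torsion-free as a ℤ_p-module.  Then a
   finite R-module M occurs as a cokernel if and only if M has projective dimension at
   most 1 as an R-module, i.e. M admits a resolution 0 → P₁ → P₀ → M → 0 with P₀, P₁
   projective. -/

open IsLocalRing

/-- `M` admits a projective resolution `0 → P₁ → P₀ → M → 0` of length 1, i.e. has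
projective dimension at most 1. -/
def HasProjDimLEOne (R M : Type) [CommRing R] [AddCommGroup M] [Module R M] : Prop :=
  ∃ (P₀ P₁ : ModuleCat.{0} R) (f : P₁ →ₗ[R] P₀) (g : P₀ →ₗ[R] M),
    Module.Projective R P₀ ∧ Module.Projective R P₁ ∧
    Function.Injective f ∧ Function.Surjective g ∧ LinearMap.range f = LinearMap.ker g


theorem aux_nzd (p : ℕ) [Fact p.Prime] (R : Type) [CommRing R]
    [Algebra ℤ_[p] R] [NoZeroSMulDivisors ℤ_[p] R] (n : ℕ) (hn : n ≠ 0) :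
    ∀ x : R, (n : R) * x = 0 → x = 0 := by
  intro x hx
  have h : ((n : ℤ_[p])) • x = 0 := by
    rw [Algebra.smul_def, map_natCast, hx]
  rcases smul_eq_zero.1 h with h | h
  · exact absurd (by exact_mod_cast h) hn
  · exact h

theorem aux_fwd {R : Type} [CommRing R] (n : ℕ) (hn : ∀ x : R, (n : R) * x = 0 → x = 0)
    (N : ℕ) (G : (Fin N → R) →ₗ[R] (Fin N → R))
    (hG : ∀ x, (n : R) • x ∈ LinearMap.range G) : Function.Injective G := by
  choose b hb using hG
  let B : (Fin N → R) →ₗ[R] (Fin N → R) := (Pi.basisFun R (Fin N)).constr R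
    (fun i => b (Pi.basisFun R (Fin N) i))
  have hGB : G ∘ₗ B = (n : R) • LinearMap.id := by
    refine (Pi.basisFun R (Fin N)).ext fun i => ?_
    simp only [LinearMap.comp_apply, B, Module.Basis.constr_basis, hb, LinearMap.smul_apply,
      LinearMap.id_apply]
  have hdet : LinearMap.det G * LinearMap.det B = (n : R) ^ N := by
    rw [← LinearMap.det_comp, hGB, LinearMap.det_smul]
    by_cases hR : Nontrivial R
    · simp
    · rw [not_nontrivial_iff_subsingleton] at hR
      exact Subsingleton.elim _ _
  have hpow : ∀ k : ℕ, ∀ x : R, (n : R) ^ k * x = 0 → x = 0 := by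
    intro k
    induction k with
    | zero => simp
    | succ k ih =>
      intro x hx
      rw [pow_succ, mul_assoc] at hx
      exact hn _ (ih _ hx)
  have hM : LinearMap.toMatrix' G = LinearMap.toMatrix' G := rfl
  rw [injective_iff_map_eq_zero]
  intro x hx
  have h1 : (LinearMap.toMatrix' G).mulVec x = 0 := by
    rw [LinearMap.toMatrix'_mulVec, hx]
  have h2 : (LinearMap.det G) • x = 0 := by
    have := congrArg (fun y => (LinearMap.toMatrix' G).adjugate.mulVec y) h1
    simp only [Matrix.mulVec_mulVec, Matrix.adjugate_mul, Matrix.mulVec_zero,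
      LinearMap.det_toMatrix', Matrix.smul_mulVec, Matrix.one_mulVec] at this
    exact this
  funext i
  refine hpow N _ ?_
  have h3 := congrFun h2 i
  simp only [Pi.smul_apply, smul_eq_mul, Pi.zero_apply] at h3
  rw [← hdet, mul_right_comm, h3, zero_mul]

theorem aux_schanuel {R : Type} [CommRing R] {M P₀ P₁ F : Type} [AddCommGroup M] [Module R M]
    [AddCommGroup P₀] [Module R P₀] [AddCommGroup P₁] [Module R P₁] [AddCommGroup F] [Module R F]
    [Module.Projective R P₀] [Module.Projective R P₁] [Module.Projective R F]
    (f : P₁ →ₗ[R] P₀) (g : P₀ →ₗ[R] M) (hf : Function.Injective f) (hg : Function.Surjective g)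
    (hfg : LinearMap.range f = LinearMap.ker g) (h : F →ₗ[R] M) (hh : Function.Surjective h) :
    Module.Projective R (LinearMap.ker h) := by
  obtain ⟨u, hu⟩ := Module.projective_lifting_property g h hg
  obtain ⟨v, hv⟩ := Module.projective_lifting_property h g hh
  have hu' : ∀ x, g (u x) = h x := fun x => LinearMap.congr_fun hu x
  have hv' : ∀ x, h (v x) = g x := fun x => LinearMap.congr_fun hv x
  let e := LinearEquiv.ofInjective f hf
  let c : LinearMap.ker h →ₗ[R] LinearMap.range f :=
    (u ∘ₗ (LinearMap.ker h).subtype).codRestrict _ (by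
      intro x
      rw [hfg, LinearMap.mem_ker]
      simp only [LinearMap.comp_apply, Submodule.subtype_apply, hu']
      exact x.2)
  let s : LinearMap.ker h →ₗ[R] P₁ × F :=
    (e.symm.toLinearMap ∘ₗ c).prod (LinearMap.ker h).subtype
  let r : P₁ × F →ₗ[R] LinearMap.ker h :=
    ((v ∘ₗ f).coprod (LinearMap.id - v ∘ₗ u)).codRestrict _ (by
      rintro ⟨y, x⟩
      have : g (f y) = 0 := by
        rw [← LinearMap.mem_ker, ← hfg]; exact ⟨y, rfl⟩
      simp [hv', hu', this])
  refine Module.Projective.of_split s r ?_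
  ext k
  have : f (e.symm (c k)) = u k := by
    have := congrArg Subtype.val (e.apply_symm_apply (c k))
    exact this
  simp [r, s, this]

theorem statement2 (p : ℕ) [Fact p.Prime] (R : Type) [CommRing R] [IsLocalRing R]
    [Algebra ℤ_[p] R] (hinj : Function.Injective (algebraMap ℤ_[p] R))
    [Module.Finite ℤ_[p] R] [Finite (ResidueField R)]
    [NoZeroSMulDivisors ℤ_[p] R]
    (M : Type) [AddCommGroup M] [Module R M] [Finite M] :
    OccursAsCokernel R M ↔ HasProjDimLEOne R M := by
  have hn := aux_nzd p R (Nat.card M) Nat.card_pos.ne'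
  have hM : ∀ m : M, (Nat.card M : R) • m = 0 := by
    intro m
    rw [Nat.cast_smul_eq_nsmul]
    exact card_nsmul_eq_zero'
  constructor
  · rintro ⟨N, -, G, ⟨e⟩⟩
    refine ⟨ModuleCat.of R (Fin N → R), ModuleCat.of R (Fin N → R), G,
      e.toLinearMap ∘ₗ (LinearMap.range G).mkQ, ?_, ?_, ?_, ?_, ?_⟩
    · change Module.Projective R (Fin N → R); infer_instance
    · change Module.Projective R (Fin N → R); infer_instance
    · refine aux_fwd _ hn N G fun x => ?_
      rw [← Submodule.Quotient.mk_eq_zero]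
      apply e.injective
      rw [Submodule.Quotient.mk_smul, map_smul, hM, map_zero]
    · exact e.surjective.comp (Submodule.mkQ_surjective _)
    · rw [LinearEquiv.ker_comp, Submodule.ker_mkQ]
  · rintro ⟨P₀, P₁, f, g, h0, h1, hf, hg, hfg⟩
    have : IsNoetherianRing R := IsNoetherianRing.of_finite ℤ_[p] R
    obtain ⟨N, h, hh⟩ : ∃ (N : ℕ) (h : (Fin (N + 1) → R) →ₗ[R] M), Function.Surjective h := by
      obtain ⟨N, h, hh⟩ := Module.Finite.exists_fin' R M
      refine ⟨N, h ∘ₗ LinearMap.funLeft R R Fin.castSucc, hh.comp ?_⟩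
      exact LinearMap.funLeft_surjective_of_injective _ _ _ (Fin.castSucc_injective N)
    have hK := aux_schanuel f g hf hg hfg h hh
    have : Module.Free R (LinearMap.ker h) := Module.free_of_flat_of_isLocalRing
    have hr : Module.finrank R (LinearMap.ker h) = N + 1 := by
      apply le_antisymm
      · have := LinearMap.finrank_le_finrank_of_injective (f := (LinearMap.ker h).subtype)
          (Submodule.injective_subtype _)
        simpa using this
      · let m : (Fin (N + 1) → R) →ₗ[R] LinearMap.ker h :=
          ((Nat.card M : R) • LinearMap.id).codRestrict _ (by
            intro x
            simp only [LinearMap.smul_apply, LinearMap.id_apply, LinearMap.mem_ker, map_smul, hM])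
        have hm : Function.Injective m := by
          rw [injective_iff_map_eq_zero]
          intro x hx
          funext i
          exact hn _ (congrFun (congrArg Subtype.val hx) i)
        have := LinearMap.finrank_le_finrank_of_injective hm
        simpa using this
    let b := (Module.finBasisOfFinrankEq R (LinearMap.ker h) hr).equivFun
    refine ⟨N + 1, N.succ_pos, (LinearMap.ker h).subtype ∘ₗ b.symm.toLinearMap, ⟨?_⟩⟩
    refine (Submodule.quotEquivOfEq _ (LinearMap.ker h) ?_).trans
      (h.quotKerEquivOfSurjective hh)
    rw [LinearEquiv.range_comp, Submodule.range_subtype]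
end

section
/- Let p be a prime, d ≥ 1, P(x) ∈ Z_p[x] a monic polynomial, and A a d×d matrix over Z_p. Set R = Z_p[x]/(P(x)). Then there is an isomorphism of Z_p[x]-modules R^d/((x·I − A)·R^d) ≅ Z_p^d/(P(A)·Z_p^d), where x·I − A is viewed as a d×d matrix over R and x acts on the right-hand side as the matrix A. -/
open Polynomial

section helpers

variable {K : Type*} [CommRing K] {d : ℕ}

noncomputable def evE (A : Matrix (Fin d) (Fin d) K) (v : Fin d → K[X]) : Fin d → K :=
  ∑ i, (aeval A (v i)).mulVec (Pi.single i 1)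

lemma evE_add (A : Matrix (Fin d) (Fin d) K) (v w : Fin d → K[X]) :
    evE A (v + w) = evE A v + evE A w := by
  simp only [evE, Pi.add_apply, map_add, Matrix.add_mulVec, Finset.sum_add_distrib]

lemma evE_sub (A : Matrix (Fin d) (Fin d) K) (v w : Fin d → K[X]) :
    evE A (v - w) = evE A v - evE A w := by
  have := evE_add A (v - w) w
  rw [sub_add_cancel] at this
  rw [this, add_sub_cancel_right]

lemma evE_smul (A : Matrix (Fin d) (Fin d) K) (f : K[X]) (v : Fin d → K[X]) :
    evE A (f • v) = (aeval A f).mulVec (evE A v) := by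
  simp only [evE, Pi.smul_apply, smul_eq_mul, map_mul, ← Matrix.mulVec_mulVec]
  rw [Matrix.mulVec_sum]

lemma sum_single (w : Fin d → K) : ∑ i, w i • (Pi.single i 1 : Fin d → K) = w := by
  ext j
  simp [Finset.sum_apply, Pi.single_apply]

lemma evE_C (A : Matrix (Fin d) (Fin d) K) (w : Fin d → K) :
    evE A (fun i => C (w i)) = w := by
  have : evE A (fun i => C (w i)) = ∑ i, w i • (Pi.single i 1 : Fin d → K) := by
    unfold evE
    refine Finset.sum_congr rfl fun i _ => ?_
    rw [aeval_C, Algebra.algebraMap_eq_smul_one, Matrix.smul_mulVec, Matrix.one_mulVec]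
  rw [this, sum_single]

lemma evE_A (A : Matrix (Fin d) (Fin d) K) (v : Fin d → K[X]) :
    evE A ((A.map C).mulVec v) = A.mulVec (evE A v) := by
  have h1 : evE A ((A.map C).mulVec v) =
      ∑ i, ∑ j, (aeval A (v j)).mulVec (A i j • (Pi.single i 1 : Fin d → K)) := by
    unfold evE
    refine Finset.sum_congr rfl fun i _ => ?_
    simp only [Matrix.mulVec, dotProduct, Matrix.map_apply]
    change (aeval A (∑ j, C (A i j) * v j)).mulVec _ = ∑ j, (aeval A (v j)).mulVec _
    rw [map_sum, Matrix.sum_mulVec]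
    refine Finset.sum_congr rfl fun j _ => ?_
    rw [map_mul, aeval_C, Algebra.algebraMap_eq_smul_one, smul_mul_assoc, one_mul,
      Matrix.smul_mulVec, Matrix.mulVec_smul]
  rw [h1, Finset.sum_comm]
  unfold evE
  rw [Matrix.mulVec_sum]
  refine Finset.sum_congr rfl fun j _ => ?_
  rw [← Matrix.mulVec_sum, sum_single (fun i => A i j), Matrix.mulVec_mulVec]
  have : A * aeval A (v j) = aeval A (v j) * A := by
    have := congrArg (aeval A) (mul_comm X (v j))
    simpa using this
  rw [this, ← Matrix.mulVec_mulVec]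
  congr 1
  ext i
  simp

lemma general {S : Type*} [CommRing S] [Algebra K S] (π : K[X] →+* S)
    (hC : ∀ a, π (C a) = algebraMap K S a) (hs : Function.Surjective π) (P : K[X])
    (hk : ∀ f, π f = 0 ↔ P ∣ f) (A : Matrix (Fin d) (Fin d) K) :
    ∃ e : ((Fin d → S) ⧸ LinearMap.range (Matrix.toLin'
              (Matrix.scalar (Fin d) (π X) - A.map (fun a => π (C a))))) ≃ₗ[K]
          ((Fin d → K) ⧸ LinearMap.range (Matrix.toLin' (aeval A P))),
      ∀ w : Fin d → K,
        e.symm (Submodule.Quotient.mk (A.mulVec w)) =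
          (π X) • e.symm (Submodule.Quotient.mk w) := by
  set N := LinearMap.range (Matrix.toLin'
              (Matrix.scalar (Fin d) (π X) - A.map (fun a => π (C a)))) with hN
  let g : (Fin d → K) →ₗ[K] ((Fin d → S) ⧸ N) :=
    { toFun := fun w => Submodule.Quotient.mk (fun i => π (C (w i)))
      map_add' := fun v w => by
        rw [← Submodule.Quotient.mk_add]
        congr 1
        ext i
        simp
      map_smul' := fun c w => by
        rw [RingHom.id_apply, ← Submodule.Quotient.mk_smul]
        congr 1
        ext i
        simp only [Pi.smul_apply, smul_eq_mul, map_mul]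
        rw [Algebra.smul_def, hC] }
  have gdef : ∀ w, g w = Submodule.Quotient.mk (fun i => π (C (w i))) := fun w => rfl
  have gA : ∀ w, g (A.mulVec w) = π X • g w := by
    intro w
    symm
    rw [gdef, gdef, ← Submodule.Quotient.mk_smul, Submodule.Quotient.eq, hN]
    refine ⟨fun i => π (C (w i)), ?_⟩
    rw [Matrix.toLin'_apply, Matrix.sub_mulVec]
    congr 1
    · ext i
      simp [Matrix.scalar_apply, Matrix.mulVec_diagonal]
    · ext i
      simp [Matrix.mulVec, dotProduct]
  have gf : ∀ (f : K[X]) w, g ((aeval A f).mulVec w) = π f • g w := by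
    intro f
    induction f using Polynomial.induction_on with
    | C a =>
      intro w
      rw [aeval_C, Algebra.algebraMap_eq_smul_one, Matrix.smul_mulVec, Matrix.one_mulVec, map_smul,
        gdef, ← Submodule.Quotient.mk_smul, ← Submodule.Quotient.mk_smul]
      congr 1
      ext i
      simp only [Pi.smul_apply, smul_eq_mul]
      rw [Algebra.smul_def, hC a]
    | add f h hf hh =>
      intro w
      rw [map_add, Matrix.add_mulVec, map_add, hf, hh, map_add, add_smul]
    | monomial n a ih =>
      intro w
      rw [pow_succ, ← mul_assoc, map_mul, aeval_X, ← Matrix.mulVec_mulVec, ih, gA, map_mul π _ X,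
        mul_smul]
  have hle : LinearMap.range (Matrix.toLin' (Polynomial.aeval A P)) ≤ LinearMap.ker g := by
    rintro _ ⟨w, rfl⟩
    rw [LinearMap.mem_ker, Matrix.toLin'_apply, gf]
    have : π P = 0 := (hk P).2 dvd_rfl
    rw [this, zero_smul]
  have hge : LinearMap.ker g ≤ LinearMap.range (Matrix.toLin' (Polynomial.aeval A P)) := by
    intro w hw
    rw [LinearMap.mem_ker, gdef, Submodule.Quotient.mk_eq_zero, hN] at hw
    obtain ⟨v, hv⟩ := hw
    choose v' hv' using fun i => hs (v i)
    have hv'' : v = fun i => π (v' i) := funext fun i => (hv' i).symm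
    have h1 : ∀ i, ∃ u, C (w i) - (X * v' i - (A.map C).mulVec v' i) = P * u := by
      intro i
      rw [← dvd_def, ← hk, map_sub, sub_eq_zero]
      have := congrFun hv i
      rw [Matrix.toLin'_apply, Matrix.sub_mulVec, hv''] at this
      rw [← this]
      simp [Matrix.scalar_apply, Matrix.mulVec_diagonal, Matrix.mulVec, dotProduct]
    choose u hu using h1
    have h2 : (fun i => C (w i)) - ((X : K[X]) • v' - (A.map C).mulVec v') = P • u := by
      ext1 i
      simp only [Pi.sub_apply, Pi.smul_apply, smul_eq_mul]
      exact hu i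
    have h3 := congrArg (evE A) h2
    rw [evE_sub, evE_sub, evE_smul, evE_smul, evE_A, aeval_X, evE_C, sub_self, sub_zero] at h3
    exact ⟨evE A u, by rw [Matrix.toLin'_apply, h3]⟩
  have hsurj : Function.Surjective g := by
    intro y
    obtain ⟨v, rfl⟩ := Submodule.Quotient.mk_surjective _ y
    choose v' hv' using fun i => hs (v i)
    refine ⟨evE A v', ?_⟩
    unfold evE
    rw [map_sum]
    simp only [gf, gdef, ← Submodule.Quotient.mk_smul]
    rw [← Submodule.mkQ_apply]
    simp only [← Submodule.mkQ_apply]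
    rw [← map_sum]
    congr 1
    ext j
    rw [← hv' j, Finset.sum_apply, Finset.sum_eq_single j]
    · simp
    · intro i _ hij
      simp [Pi.single_apply, hij.symm]
    · simp
  let G := Submodule.liftQ _ g hle
  have hG : Function.Bijective G := by
    constructor
    · rw [← LinearMap.ker_eq_bot]
      exact Submodule.ker_liftQ_eq_bot _ _ _ hge
    · intro y
      obtain ⟨w, rfl⟩ := hsurj y
      exact ⟨Submodule.Quotient.mk w, rfl⟩
  refine ⟨(LinearEquiv.ofBijective G hG).symm, fun w => ?_⟩
  exact gA w

end helpers

theorem statement3 (p : ℕ) [Fact p.Prime] (d : ℕ) (hd : 1 ≤ d)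
    (P : Polynomial ℤ_[p]) (hP : P.Monic) (A : Matrix (Fin d) (Fin d) ℤ_[p]) :
    ∃ e : ((Fin d → (Polynomial ℤ_[p] ⧸ Ideal.span {P})) ⧸
            LinearMap.range (Matrix.toLin'
              (Matrix.scalar (Fin d) (Ideal.Quotient.mk (Ideal.span {P}) Polynomial.X) -
                A.map (fun a => Ideal.Quotient.mk (Ideal.span {P}) (Polynomial.C a)))))
          ≃ₗ[ℤ_[p]]
          ((Fin d → ℤ_[p]) ⧸ LinearMap.range (Matrix.toLin' (Polynomial.aeval A P))),
      ∀ w : Fin d → ℤ_[p],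
        e.symm (Submodule.Quotient.mk (A.mulVec w)) =
          (Ideal.Quotient.mk (Ideal.span {P}) Polynomial.X) •
            e.symm (Submodule.Quotient.mk w) := by
  exact general (Ideal.Quotient.mk (Ideal.span {P})) (fun _ => rfl) Ideal.Quotient.mk_surjective P
    (fun f => by rw [Ideal.Quotient.eq_zero_iff_mem, Ideal.mem_span_singleton]) A
end

section
/- For every finite R-module M: if M occurs as a cokernel then lim_{N→∞} μ_{R,N}(M) = c_R/#Aut_R(M); if M does not occur as a cokernel then μ_{R,N}(M) = 0 for every N. -/
/- STATEMENT 4: For every finite R-module M: if M occurs as a cokernel then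
   lim_{N→∞} μ_{R,N}(M) = c_R/#Aut_R(M); if M does not occur as a cokernel then
   μ_{R,N}(M) = 0 for every N.

   Here μ_{R,N}(M) = Haar_N({G ∈ End_R(R^N) : coker G ≅ M}), where Haar_N is the Haar
   probability measure on the profinite group End_R(R^N).  Since End_R(R^N) is the
   inverse limit of the finite groups End_{R/p^k}((R/p^k)^N), and for every finite
   R-module M the set {G : coker G ≅ M} is the preimage of the corresponding set at any
   sufficiently large finite level k, this Haar measure equals the limit as k → ∞ of the
   proportion, among all G ∈ End_{R/p^k}((R/p^k)^N), of those with coker G ≅ M (as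
   R-modules); the sequence of proportions is eventually constant.  We take this
   limit description as the definition `muRN` below. -/

open IsLocalRing Filter

/-- The number of `R`-module automorphisms of `M`. -/
noncomputable def numAut (R M : Type) [CommRing R] [AddCommGroup M] [Module R M] : ℕ :=
  Nat.card (M ≃ₗ[R] M)

/-- `c_R = ∏_{i=1}^∞ (1 - |F_R|^{-i})`. -/
noncomputable def cConst (R : Type) [CommRing R] [IsLocalRing R] : ℝ :=
  ∏' i : ℕ, (1 - ((Nat.card (ResidueField R) : ℝ))⁻¹ ^ (i + 1))

/-- The proportion, among all `R/p^k`-linear endomorphisms `G` of `(R/p^k)^N`, of those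
whose cokernel is isomorphic to `M` as an `R`-module. -/
noncomputable def levelProportion (p : ℕ) (R : Type) [CommRing R] (N k : ℕ)
    (M : Type) [AddCommGroup M] [Module R M] : ℝ :=
  (Nat.card {G : Module.End (R ⧸ Ideal.span {(p : R) ^ k}) (Fin N → R ⧸ Ideal.span {(p : R) ^ k}) //
      Nonempty (((Fin N → R ⧸ Ideal.span {(p : R) ^ k}) ⧸ LinearMap.range G) ≃ₗ[R] M)} : ℝ) /
    (Nat.card (Module.End (R ⧸ Ideal.span {(p : R) ^ k}) (Fin N → R ⧸ Ideal.span {(p : R) ^ k})) : ℝ)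

/-- `μ_{R,N}(M)`: the Haar-measure of `{G ∈ End_R(R^N) : coker G ≅ M}`, computed as the
limit over finite levels `k` (the sequence is eventually constant). -/
noncomputable def muRN (p : ℕ) (R : Type) [CommRing R] (N : ℕ)
    (M : Type) [AddCommGroup M] [Module R M] : ℝ :=
  limUnder atTop (fun k => levelProportion p R N k M)

open scoped TensorProduct

lemma aux_fiber {X Y : Type*} [AddCommGroup X] [AddCommGroup Y] [Finite X] (f : X →+ Y)
    (hf : Function.Surjective f) (P : Y → Prop) :
    Nat.card {x // P (f x)} * Nat.card Y = Nat.card X * Nat.card {y // P y} := by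
  have := Finite.of_surjective f hf
  obtain ⟨s, hs⟩ := hf.hasRightInverse
  let e (Q : Y → Prop) : {x // Q (f x)} ≃ {y // Q y} × f.ker :=
    { toFun := fun x => (⟨f x.1, x.2⟩, ⟨x.1 - s (f x.1), by
        rw [AddMonoidHom.mem_ker, map_sub, hs, sub_self]⟩)
      invFun := fun y => ⟨y.2.1 + s y.1.1, by
        have := y.2.2
        rw [AddMonoidHom.mem_ker] at this
        rw [map_add, hs, this, zero_add]; exact y.1.2⟩
      left_inv := fun x => by simp
      right_inv := fun y => by
        have := y.2.2
        rw [AddMonoidHom.mem_ker] at this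
        ext <;> simp [this, hs _] }
  have h1 := Nat.card_congr (e P)
  have h2 : Nat.card X = Nat.card Y * Nat.card f.ker := by
    rw [← Nat.card_congr (Equiv.subtypeUnivEquiv (p := fun x : X => True) (fun _ => trivial)),
      Nat.card_congr (e (fun _ => True)), Nat.card_prod,
      Nat.card_congr (Equiv.subtypeUnivEquiv (p := fun x : Y => True) (fun _ => trivial))]
  rw [h1, h2, Nat.card_prod]; ring

lemma aux_span_tensor {A : Type} [CommRing A] [IsLocalRing A] {K : Type} [AddCommGroup K]
    [Module A K] [Module.Finite A K] {ι : Type} (w : ι → K) :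
    Submodule.span A (Set.range w) = ⊤ ↔ Submodule.span (ResidueField A)
      (Set.range fun i => TensorProduct.mk A (ResidueField A) K 1 (w i)) = ⊤ := by
  rw [← map_tensorProduct_mk_eq_top, Submodule.map_span, ← Submodule.restrictScalars_span A
    (ResidueField A) Ideal.Quotient.mk_surjective, Submodule.restrictScalars_eq_top_iff,
    ← Set.range_comp]
  rfl

lemma aux_span_count {A : Type} [CommRing A] [IsLocalRing A] [Finite (ResidueField A)]
    {K : Type} [AddCommGroup K] [Module A K] [Finite K] (N : ℕ)
    (h : Module.finrank (ResidueField A) (ResidueField A ⊗[A] K) = N) :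
    Nat.card {w : Fin N → K // Submodule.span A (Set.range w) = ⊤} *
      Nat.card (ResidueField A) ^ (N * N) =
    Nat.card K ^ N * ∏ i : Fin N, (Nat.card (ResidueField A) ^ N -
      Nat.card (ResidueField A) ^ i.val) := by
  have : Module.Finite A K := Module.Finite.of_finite
  have : Finite (ResidueField A ⊗[A] K) := Module.finite_of_finite (ResidueField A)
  have : Fintype (ResidueField A ⊗[A] K) := Fintype.ofFinite _
  have : Fintype (ResidueField A) := Fintype.ofFinite _
  have hs : Function.Surjective (TensorProduct.mk A (ResidueField A) K 1) :=
    TensorProduct.mk_surjective A K (ResidueField A) Ideal.Quotient.mk_surjective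
  let f : (Fin N → K) →+ (Fin N → ResidueField A ⊗[A] K) :=
    ((TensorProduct.mk A (ResidueField A) K 1).compLeft (Fin N)).toAddMonoidHom
  have hf : Function.Surjective f := hs.comp_left
  have key := aux_fiber f hf (fun w => LinearIndependent (ResidueField A) w)
  have e1 : ∀ w : Fin N → K, Submodule.span A (Set.range w) = ⊤ ↔
      LinearIndependent (ResidueField A) (f w) := by
    intro w
    rw [aux_span_tensor]
    constructor
    · intro hw
      exact linearIndependent_of_top_le_span_of_card_eq_finrank hw.ge (by simp [h])
    · intro hw
      exact hw.span_eq_top_of_card_eq_finrank' (by simp [h])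
  rw [card_linearIndependent (by rw [h]), h] at key
  simp only [e1]
  have hc : Nat.card (Fin N → ResidueField A ⊗[A] K) = Nat.card (ResidueField A) ^ (N * N) := by
    rw [Nat.card_fun, Module.natCard_eq_pow_finrank (K := ResidueField A), h]
    simp [pow_mul]
  rw [hc, Nat.card_fun] at key
  simpa using key

lemma aux_prod {A : Type} [CommRing A] [IsLocalRing A] {N N' : ℕ} {M : Type} [AddCommGroup M]
    [Module A M] (φ : (Fin N → A) →ₗ[A] M) (ψ : (Fin N' → A) →ₗ[A] M)
    (hφ : Function.Surjective φ) :
    Nonempty (LinearMap.ker (φ.coprod (-ψ)) ≃ₗ[A] LinearMap.ker φ × (Fin N' → A)) := by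
  obtain ⟨l, hl⟩ := Module.projective_lifting_property φ ψ hφ
  have hl' : ∀ y, φ (l y) = ψ y := fun y => LinearMap.congr_fun hl y
  refine ⟨LinearEquiv.ofLinearMap
    (LinearMap.prod (LinearMap.codRestrict _ ((LinearMap.fst A _ _ - l ∘ₗ LinearMap.snd A _ _) ∘ₗ
      Submodule.subtype _) ?_) (LinearMap.snd A _ _ ∘ₗ Submodule.subtype _))
    (LinearMap.codRestrict _ (LinearMap.prod ((Submodule.subtype _).comp (LinearMap.fst A _ _) +
      l ∘ₗ LinearMap.snd A _ _) (LinearMap.snd A _ _)) ?_) ?_ ?_⟩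
  · rintro ⟨⟨x, y⟩, h⟩
    simp at h
    simp [hl', sub_eq_add_neg, h]
  · rintro ⟨⟨x, hx⟩, y⟩
    simp at hx
    simp [hx, hl']
  · ext x <;> simp
  · ext x <;> simp

lemma aux_schanuel_s4 {A : Type} [CommRing A] [IsLocalRing A] [Finite A] {N N' : ℕ} {M : Type}
    [AddCommGroup M]
    [Module A M] (φ : (Fin N → A) →ₗ[A] M) (ψ : (Fin N' → A) →ₗ[A] M)
    (hφ : Function.Surjective φ) (hψ : Function.Surjective ψ) :
    Module.finrank (ResidueField A) (ResidueField A ⊗[A] LinearMap.ker φ) + N' =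
    Module.finrank (ResidueField A) (ResidueField A ⊗[A] LinearMap.ker ψ) + N := by
  obtain ⟨e1⟩ := aux_prod φ ψ hφ
  obtain ⟨e2⟩ := aux_prod ψ φ hψ
  have e3 : LinearMap.ker (φ.coprod (-ψ)) ≃ₗ[A] LinearMap.ker (ψ.coprod (-φ)) := by
    refine LinearEquiv.ofSubmodules (LinearEquiv.prodComm A _ _) _ _ ?_
    ext ⟨y, x⟩
    simp [Submodule.mem_map_equiv, LinearMap.mem_ker]
    constructor <;> intro h
    · rw [← sub_eq_add_neg] at *; rw [sub_eq_zero] at *; exact h.symm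
    · rw [← sub_eq_add_neg] at *; rw [sub_eq_zero] at *; exact h.symm
  have e := (e1.symm.trans e3).trans e2
  have e' := (TensorProduct.prodRight A (ResidueField A) (ResidueField A) _ _).symm.trans
    ((e.baseChange A (ResidueField A)).trans
    (TensorProduct.prodRight A (ResidueField A) (ResidueField A) _ _))
  have := e'.finrank_eq
  rw [Module.finrank_prod, Module.finrank_prod] at this
  simpa using this

lemma aux_card_ker {A : Type} [CommRing A] [Finite A] {N : ℕ} {M : Type} [AddCommGroup M]
    [Module A M] (φ : (Fin N → A) →ₗ[A] M) (hφ : Function.Surjective φ) :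
    Nat.card (LinearMap.ker φ) * Nat.card M = Nat.card A ^ N := by
  have h1 := Submodule.card_eq_card_quotient_mul_card (LinearMap.ker φ)
  rw [Nat.card_congr (φ.quotKerEquivOfSurjective hφ).toEquiv, Nat.card_fun] at h1
  rw [← h1]; simp

lemma aux_finrank {A : Type} [CommRing A] [IsLocalRing A] [Finite A] {N N' : ℕ} {M : Type}
    [AddCommGroup M] [Finite M]
    [Module A M] (hc : Nat.card M < Nat.card A) (φ : (Fin N → A) →ₗ[A] M)
    (ψ : (Fin N' → A) →ₗ[A] M)
    (hφ : Function.Surjective φ) (hψ : Function.Surjective ψ)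
    (w : Fin N' → LinearMap.ker ψ) (hw : Submodule.span A (Set.range w) = ⊤) :
    Module.finrank (ResidueField A) (ResidueField A ⊗[A] LinearMap.ker φ) = N := by
  have hS := aux_schanuel_s4 φ ψ hφ hψ
  have h1 : Module.finrank (ResidueField A) (ResidueField A ⊗[A] LinearMap.ker ψ) ≤ N' := by
    rw [aux_span_tensor] at hw
    have := finrank_range_le_card (R := ResidueField A)
      (fun i => TensorProduct.mk A (ResidueField A) (LinearMap.ker ψ) 1 (w i))
    rw [Set.finrank, hw, finrank_top] at this
    simpa using this
  apply le_antisymm (by omega)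
  set d := Module.finrank (ResidueField A) (ResidueField A ⊗[A] LinearMap.ker φ) with hd
  let b := Module.finBasis (ResidueField A) (ResidueField A ⊗[A] LinearMap.ker φ)
  have hs : Function.Surjective (TensorProduct.mk A (ResidueField A) (LinearMap.ker φ) 1) :=
    TensorProduct.mk_surjective A _ (ResidueField A) Ideal.Quotient.mk_surjective
  choose u hu using fun i => hs (b i)
  have hsp := span_eq_top_of_tmul_eq_basis u b hu
  have hsurj : Function.Surjective (Fintype.linearCombination A u) := by
    rw [← LinearMap.range_eq_top, Fintype.range_linearCombination, hsp]
  have h2 := Nat.card_le_card_of_surjective _ hsurj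
  rw [Nat.card_fun] at h2
  rw [Nat.card_fin] at h2
  have h3 := aux_card_ker φ hφ
  have h4 : Nat.card A ^ N < Nat.card A ^ (d + 1) := by
    rw [← h3, pow_succ]
    have : 0 < Nat.card A := Nat.card_pos
    calc _ ≤ Nat.card A ^ d * Nat.card M := Nat.mul_le_mul_right _ h2
      _ < _ := Nat.mul_lt_mul_of_pos_left hc (by positivity)
  have := (Nat.pow_lt_pow_iff_right (Finite.one_lt_card)).1 h4
  omega

lemma aux_range_count {A : Type} [CommRing A] (N : ℕ)
    (L : Submodule A (Fin N → A)) :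
    Nat.card {G : Module.End A (Fin N → A) // LinearMap.range G = L} =
    Nat.card {w : Fin N → L // Submodule.span A (Set.range w) = ⊤} := by
  have hr : ∀ w : Fin N → L, Submodule.span A (Set.range w) = ⊤ ↔
      Submodule.span A (Set.range fun i => (w i : Fin N → A)) = L := by
    intro w
    rw [← (Submodule.map_injective_of_injective L.injective_subtype).eq_iff, Submodule.map_span,
      Submodule.map_top, Submodule.range_subtype, ← Set.range_comp]
    rfl
  let c := (Pi.basisFun A (Fin N)).constr (M' := Fin N → A) A
  have hcr : ∀ G : Module.End A (Fin N → A), LinearMap.range G =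
      Submodule.span A (Set.range (c.symm G)) := by
    intro G
    rw [← Module.Basis.constr_range (S := A) (Pi.basisFun A (Fin N))]
    exact congrArg _ (c.apply_symm_apply G).symm
  refine Nat.card_congr ⟨fun G => ⟨fun i => ⟨c.symm G.1 i, ?_⟩, ?_⟩,
    fun w => ⟨c fun i => (w.1 i : Fin N → A), ?_⟩, ?_, ?_⟩
  · refine (congrArg (fun Z => c.symm G.1 i ∈ Z) G.2).mp ?_
    rw [hcr]; exact Submodule.subset_span ⟨i, rfl⟩
  · rw [hr]
    change Submodule.span A (Set.range (c.symm G.1)) = L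
    rw [← hcr, G.2]
  · rw [hcr, c.symm_apply_apply, ← hr]; exact w.2
  · intro G
    ext1
    exact c.apply_symm_apply G.1
  · intro w
    ext1
    funext i
    ext1
    exact congrFun (c.symm_apply_apply _) i

lemma aux_surj_count {A : Type} [CommRing A] (N : ℕ) (M : Type) [AddCommGroup M] [Module A M] :
    Nat.card {φ : (Fin N → A) →ₗ[A] M // Function.Surjective φ} =
    Nat.card {v : Fin N → M // Submodule.span A (Set.range v) = ⊤} := by
  refine Nat.card_congr (Equiv.subtypeEquiv
    ((Pi.basisFun A (Fin N)).constr (M' := M) A).toEquiv.symm ?_)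
  intro φ
  rw [← LinearMap.range_eq_top, ← Module.Basis.constr_range (S := A) (Pi.basisFun A (Fin N))]
  erw [LinearEquiv.apply_symm_apply]

lemma aux_torsor {A : Type} [CommRing A] {E M : Type} [AddCommGroup E] [Module A E]
    [AddCommGroup M] [Module A M] (L : Submodule A E) (h : Nonempty ((E ⧸ L) ≃ₗ[A] M)) :
    Nat.card {φ : E →ₗ[A] M // Function.Surjective φ ∧ L = LinearMap.ker φ} =
      Nat.card (M ≃ₗ[A] M) := by
  obtain ⟨e⟩ := h
  refine Nat.card_congr (Equiv.symm ⟨fun a => ⟨(a : M →ₗ[A] M) ∘ₗ (e : (E ⧸ L) →ₗ[A] M) ∘ₗ L.mkQ, ?_, ?_⟩,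
    fun φ => e.symm.trans ((Submodule.quotEquivOfEq _ _ φ.2.2).trans
      (φ.1.quotKerEquivOfSurjective φ.2.1)), ?_, ?_⟩)
  · exact a.surjective.comp (e.surjective.comp L.mkQ_surjective)
  · ext x; simp
  · intro a
    ext x
    obtain ⟨y, rfl⟩ := e.surjective x
    obtain ⟨y, rfl⟩ := L.mkQ_surjective y
    simp
  · intro φ
    ext x
    simp

lemma aux_core {A : Type} [CommRing A] [IsLocalRing A] [Finite A] {N' : ℕ} {M : Type}
    [AddCommGroup M] [Finite M]
    [Module A M] (hc : Nat.card M < Nat.card A) (ψ : (Fin N' → A) →ₗ[A] M)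
    (hψ : Function.Surjective ψ)
    (w : Fin N' → LinearMap.ker ψ) (hw : Submodule.span A (Set.range w) = ⊤) (N : ℕ) :
    Nat.card {G : Module.End A (Fin N → A) //
      Nonempty (((Fin N → A) ⧸ LinearMap.range G) ≃ₗ[A] M)} * Nat.card (M ≃ₗ[A] M) *
      (Nat.card M ^ N * Nat.card (ResidueField A) ^ (N * N)) =
    Nat.card {v : Fin N → M // Submodule.span A (Set.range v) = ⊤} *
      (Nat.card A ^ (N * N) * ∏ i : Fin N, (Nat.card (ResidueField A) ^ N -
      Nat.card (ResidueField A) ^ i.val)) := by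
  classical
  have : Finite (ResidueField A) := Finite.of_surjective _ (residue_surjective (R := A))
  have : Finite (Module.End A (Fin N → A)) := 
    Finite.of_injective _ (DFunLike.coe_injective (F := Module.End A (Fin N → A)))
  have : Finite ((Fin N → A) →ₗ[A] M) :=
    Finite.of_injective _ (DFunLike.coe_injective (F := (Fin N → A) →ₗ[A] M))
  have : Fintype (Module.End A (Fin N → A)) := Fintype.ofFinite _
  have : Fintype ((Fin N → A) →ₗ[A] M) := Fintype.ofFinite _
  let S := {x : Module.End A (Fin N → A) × ((Fin N → A) →ₗ[A] M) //
    Function.Surjective x.2 ∧ LinearMap.range x.1 = LinearMap.ker x.2}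
  let e1 : S ≃ Σ G : {G : Module.End A (Fin N → A) //
      Nonempty (((Fin N → A) ⧸ LinearMap.range G) ≃ₗ[A] M)},
      {φ : (Fin N → A) →ₗ[A] M // Function.Surjective φ ∧ LinearMap.range G.1 = LinearMap.ker φ} :=
    { toFun := fun x => ⟨⟨x.1.1, ⟨(Submodule.quotEquivOfEq _ _ x.2.2).trans
        (x.1.2.quotKerEquivOfSurjective x.2.1)⟩⟩, ⟨x.1.2, x.2⟩⟩
      invFun := fun y => ⟨(y.1.1, y.2.1), y.2.2⟩
      left_inv := fun _ => rfl
      right_inv := fun _ => rfl }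
  let e2 : S ≃ Σ φ : {φ : (Fin N → A) →ₗ[A] M // Function.Surjective φ},
      {G : Module.End A (Fin N → A) // LinearMap.range G = LinearMap.ker φ.1} :=
    { toFun := fun x => ⟨⟨x.1.2, x.2.1⟩, ⟨x.1.1, x.2.2⟩⟩
      invFun := fun y => ⟨(y.2.1, y.1.1), y.1.2, y.2.2⟩
      left_inv := fun _ => rfl
      right_inv := fun _ => rfl }
  have c1 : Nat.card S = Nat.card {G : Module.End A (Fin N → A) //
      Nonempty (((Fin N → A) ⧸ LinearMap.range G) ≃ₗ[A] M)} * Nat.card (M ≃ₗ[A] M) := by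
    rw [Nat.card_congr e1, Nat.card_sigma, Finset.sum_congr rfl (fun G _ => aux_torsor _ G.2)]
    simp
  have c2 : Nat.card S * (Nat.card M ^ N * Nat.card (ResidueField A) ^ (N * N)) = 
      Nat.card {φ : (Fin N → A) →ₗ[A] M // Function.Surjective φ} * 
      (Nat.card A ^ (N * N) * ∏ i : Fin N, (Nat.card (ResidueField A) ^ N -
      Nat.card (ResidueField A) ^ i.val)) := by
    rw [Nat.card_congr e2, Nat.card_sigma, Finset.sum_mul, Finset.sum_congr rfl (g := fun _ => 
      (Nat.card A ^ (N * N) * ∏ i : Fin N, (Nat.card (ResidueField A) ^ N -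
      Nat.card (ResidueField A) ^ i.val)))]
    · simp
    · rintro ⟨φ, hφ⟩ -
      have h := aux_span_count N (aux_finrank hc φ ψ hφ hψ w hw)
      rw [← aux_range_count] at h
      have h3 := aux_card_ker φ hφ
      rw [pow_mul (Nat.card A), ← h3, mul_pow]
      linear_combination (Nat.card M ^ N) * h
  rw [← c1, c2, aux_surj_count]

noncomputable def auxFormula (R M : Type) [CommRing R] [IsLocalRing R] [AddCommGroup M]
    [Module R M] (N : ℕ) : ℝ :=
  ((Nat.card {v : Fin N → M // Submodule.span R (Set.range v) = ⊤} : ℝ) / (Nat.card M : ℝ) ^ N) *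
  (∏ i ∈ Finset.range N, (1 - ((Nat.card (ResidueField R) : ℝ))⁻¹ ^ (i + 1))) / (numAut R M : ℝ)

lemma aux_prod_q (q N : ℕ) (hq : 0 < q) :
    ((∏ i : Fin N, (q ^ N - q ^ i.val) : ℕ) : ℝ) =
    (q : ℝ) ^ (N * N) * ∏ i ∈ Finset.range N, (1 - (q : ℝ)⁻¹ ^ (i + 1)) := by
  have hq' : (q : ℝ) ≠ 0 := by positivity
  rw [Finset.prod_range (fun i => (1 - (q : ℝ)⁻¹ ^ (i + 1))), pow_mul]
  have : ((q : ℝ) ^ N) ^ N = ∏ i : Fin N, (q : ℝ) ^ N := by simp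
  rw [this, ← Finset.prod_mul_distrib, ← Equiv.prod_comp Fin.revPerm, Nat.cast_prod]
  refine Finset.prod_congr rfl fun i _ => ?_
  rw [Nat.cast_sub (Nat.pow_le_pow_right hq (Fin.is_lt _).le)]
  push_cast
  have hi : i.val + 1 ≤ N := i.2
  rw [mul_sub, mul_one, Fin.revPerm_apply, Fin.val_rev, inv_pow, pow_sub₀ _ hq' hi]

lemma aux_spanSurj {R A M : Type} [CommRing R] [CommRing A] [Algebra R A]
    (hs : Function.Surjective (algebraMap R A)) [AddCommGroup M] [Module R M] [Module A M]
    [IsScalarTower R A M] (X : Set M) : Submodule.span A X = ⊤ ↔ Submodule.span R X = ⊤ := by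
  rw [← Submodule.restrictScalars_span R A hs, Submodule.restrictScalars_eq_top_iff]

lemma aux_residue_card {R A : Type} [CommRing R] [CommRing A] [Algebra R A]
    (hs : Function.Surjective (algebraMap R A)) [IsLocalRing R] [IsLocalRing A] :
    Nat.card (ResidueField A) = Nat.card (ResidueField R) := by
  have : IsLocalHom (algebraMap R A) := hs.isLocalHom
  refine (Nat.card_congr (Equiv.ofBijective (ResidueField.map (algebraMap R A))
    ⟨RingHom.injective _, ?_⟩)).symm
  intro x
  obtain ⟨a, rfl⟩ := residue_surjective x
  obtain ⟨r, rfl⟩ := hs a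
  exact ⟨residue R r, ResidueField.map_residue _ _⟩

lemma aux_level {R A M : Type} [CommRing R] [CommRing A] [Algebra R A]
    (hs : Function.Surjective (algebraMap R A)) [AddCommGroup M] [Module R M] [Module A M]
    [IsScalarTower R A M] [IsLocalRing R] [IsLocalRing A] [Finite A] [Finite M]
    (hc : Nat.card M < Nat.card A) (hocc : OccursAsCokernel R M) (N : ℕ) :
    (Nat.card {G : Module.End A (Fin N → A) //
      Nonempty (((Fin N → A) ⧸ LinearMap.range G) ≃ₗ[R] M)} : ℝ) /
    (Nat.card (Module.End A (Fin N → A)) : ℝ) = auxFormula R M N := by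
  obtain ⟨N', -, G, ⟨e⟩⟩ := hocc
  let φ : (Fin N' → R) →ₗ[R] M := (e : _ →ₗ[R] M) ∘ₗ (LinearMap.range G).mkQ
  have hφ : Function.Surjective φ := e.surjective.comp (Submodule.mkQ_surjective _)
  have hφk : LinearMap.ker φ = LinearMap.range G := by ext x; simp [φ]
  let ψ : (Fin N' → A) →ₗ[A] M := Fintype.linearCombination A fun i => φ (Pi.single i 1)
  let π : (Fin N' → R) →ₗ[R] (Fin N' → A) := (Algebra.linearMap R A).compLeft (Fin N')
  have hπ : Function.Surjective π := hs.comp_left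
  have hψπ : ∀ x, ψ (π x) = φ x := by
    intro x
    conv_rhs => rw [LinearMap.pi_apply_eq_sum_univ φ x]
    simp only [ψ, Fintype.linearCombination_apply]
    refine Finset.sum_congr rfl fun i _ => ?_
    simp [π, algebraMap_smul]
    congr 2
    ext j
    simp [Pi.single_apply, eq_comm]
  have hψ : Function.Surjective ψ := by
    intro m
    obtain ⟨x, rfl⟩ := hφ m
    exact ⟨π x, hψπ x⟩
  let w : Fin N' → LinearMap.ker ψ := fun i => ⟨π (G (Pi.single i 1)), by
    rw [LinearMap.mem_ker, hψπ, ← LinearMap.mem_ker, hφk]; exact ⟨_, rfl⟩⟩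
  have hw : Submodule.span A (Set.range w) = ⊤ := by
    rw [eq_top_iff]
    rintro ⟨x, hx⟩ -
    obtain ⟨y, rfl⟩ := hπ x
    rw [LinearMap.mem_ker, hψπ, ← LinearMap.mem_ker, hφk] at hx
    obtain ⟨z, rfl⟩ := hx
    have hz : (⟨π (G z), by rw [LinearMap.mem_ker, hψπ, ← LinearMap.mem_ker, hφk]; exact ⟨_, rfl⟩⟩ :
        LinearMap.ker ψ) = ∑ i, algebraMap R A (z i) • w i := by
      apply Subtype.ext
      have : G z = ∑ i, z i • G (Pi.single i 1) := by
        conv_lhs => rw [pi_eq_sum_univ' z]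
        rw [map_sum]
        refine Finset.sum_congr rfl fun i _ => ?_
        rw [map_smul]
      change π (G z) = _
      rw [this, map_sum, AddSubmonoidClass.coe_finsetSum]
      refine Finset.sum_congr rfl fun i _ => ?_
      rw [map_smul, ← algebraMap_smul A (z i)]
      rfl
    rw [hz]
    exact Submodule.sum_mem _ fun i _ => Submodule.smul_mem _ _ (Submodule.subset_span ⟨i, rfl⟩)
  have key := aux_core hc ψ hψ w hw N
  have h1 : Nat.card {G : Module.End A (Fin N → A) //
      Nonempty (((Fin N → A) ⧸ LinearMap.range G) ≃ₗ[A] M)} = Nat.card {G : Module.End A (Fin N → A) //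
      Nonempty (((Fin N → A) ⧸ LinearMap.range G) ≃ₗ[R] M)} := by
    refine Nat.card_congr (Equiv.subtypeEquivRight fun G => ⟨?_, ?_⟩)
    · rintro ⟨e⟩; exact ⟨e.restrictScalars R⟩
    · rintro ⟨e⟩; exact ⟨e.extendScalarsOfSurjective hs⟩
  have h2 : Nat.card (M ≃ₗ[A] M) = Nat.card (M ≃ₗ[R] M) :=
    Nat.card_congr ⟨fun e => e.restrictScalars R, fun e => e.extendScalarsOfSurjective hs,
      fun e => by ext; rfl, fun e => by ext; rfl⟩
  have h3 : Nat.card (Module.End A (Fin N → A)) = Nat.card A ^ (N * N) := by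
    rw [← Nat.card_congr ((Pi.basisFun A (Fin N)).constr (M' := Fin N → A) A).toEquiv,
      Nat.card_fun, Nat.card_fun, Nat.card_fin, pow_mul]
  have hfin : Finite (ResidueField A) := Finite.of_surjective _ (residue_surjective (R := A))
  have hq : 0 < Nat.card (ResidueField A) := Nat.card_pos
  have hfM : Finite (M ≃ₗ[R] M) :=
    Finite.of_injective _ (DFunLike.coe_injective (F := M ≃ₗ[R] M))
  have hM : 0 < Nat.card M := Nat.card_pos
  have hA : 0 < Nat.card A := Nat.card_pos
  have hAut : 0 < Nat.card (M ≃ₗ[R] M) := Nat.card_pos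
  simp only [aux_spanSurj hs] at key
  rw [h1, h2] at key
  have key' := congrArg (Nat.cast (R := ℝ)) key
  rw [Nat.cast_mul, Nat.cast_mul _ (_ * _), Nat.cast_mul _ (∏ i : Fin N, _), aux_prod_q _ _ hq,
    aux_residue_card hs] at key'
  rw [aux_residue_card hs] at hq
  push_cast at key'
  rw [h3, auxFormula, numAut]
  push_cast
  rw [div_eq_iff (by positivity)]
  have hq' : (Nat.card (ResidueField R) : ℝ) ^ (N * N) ≠ 0 := by positivity
  rw [div_mul_eq_mul_div, div_mul_eq_mul_div, div_mul_eq_mul_div, div_div,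
    eq_div_iff (by positivity)]
  apply mul_right_cancel₀ hq'
  linear_combination key'

section
variable (p : ℕ) [Fact p.Prime] (R : Type) [CommRing R] [IsLocalRing R]
    [Algebra ℤ_[p] R] [Module.Finite ℤ_[p] R]

lemma aux_p_mem : (p : R) ∈ maximalIdeal R := by
  rw [mem_maximalIdeal, mem_nonunits_iff]
  intro hu
  have h : (⊤ : Submodule ℤ_[p] R) = ⊥ := by
    refine Submodule.eq_bot_of_le_smul_of_le_jacobson_bot (maximalIdeal ℤ_[p]) ⊤
      Module.Finite.fg_top ?_ (maximalIdeal_le_jacobson _)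
    intro x _
    obtain ⟨u, hu⟩ := hu
    have : x = (p : ℤ_[p]) • ((↑u⁻¹ : R) * x) := by
      rw [Algebra.smul_def, map_natCast, ← hu, ← mul_assoc, Units.mul_inv, one_mul]
    rw [this]
    refine Submodule.smul_mem_smul ?_ trivial
    rw [PadicInt.maximalIdeal_eq_span_p]
    exact Ideal.mem_span_singleton_self _
  have h1 : (1 : R) ∈ (⊤ : Submodule ℤ_[p] R) := trivial
  rw [h, Submodule.mem_bot] at h1
  exact one_ne_zero h1

lemma aux_finite_level (k : ℕ) : Finite (R ⧸ Ideal.span {(p : R) ^ k}) := by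
  have : Finite (ℤ_[p] ⧸ Ideal.span {(p : ℤ_[p]) ^ k}) := by
    rw [← PadicInt.ker_toZModPow]
    have : NeZero (p ^ k) := ⟨pow_ne_zero _ (Fact.out : p.Prime).ne_zero⟩
    exact Finite.of_injective _ (RingHom.kerLift_injective (PadicInt.toZModPow (p := p) k))
  have : Finite (R ⧸ (⊤ : Submodule ℤ_[p] R)) := inferInstance
  have h := Submodule.finite_quotient_smul (Ideal.span {(p : ℤ_[p]) ^ k})
    (N := (⊤ : Submodule ℤ_[p] R)) Module.Finite.fg_top
  have hle : (Ideal.span {(p : ℤ_[p]) ^ k}) • (⊤ : Submodule ℤ_[p] R) ≤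
      (Ideal.span {(p : R) ^ k}).restrictScalars ℤ_[p] := by
    rw [Submodule.smul_le]
    intro r hr n _
    obtain ⟨a, rfl⟩ := Ideal.mem_span_singleton'.1 hr
    refine Ideal.mem_span_singleton'.2 ⟨algebraMap _ _ a * n, ?_⟩
    rw [Algebra.smul_def, map_mul, map_pow, map_natCast]; ring
  have hsurj := Submodule.factor_surjective hle
  exact Finite.of_surjective _ hsurj

lemma aux_card_level (hinj : Function.Injective (algebraMap ℤ_[p] R)) (k : ℕ) :
    k ≤ Nat.card (R ⧸ Ideal.span {(p : R) ^ k}) := by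
  have := aux_finite_level p R k
  have hp := aux_p_mem p R
  have hunit : ∀ x : R, IsUnit (1 - p * x) := by
    intro x
    by_contra h
    have h1 : (1 - p * x : R) ∈ maximalIdeal R := h
    have h2 := Ideal.add_mem _ h1 (Ideal.mul_mem_right x _ hp)
    rw [sub_add_cancel] at h2
    exact (Ideal.ne_top_iff_one _).1 (maximalIdeal.isMaximal R).ne_top h2
  have hne : ∀ i, (p : R) ^ i ≠ 0 := by
    intro i h
    have : algebraMap ℤ_[p] R ((p : ℤ_[p]) ^ i) = algebraMap ℤ_[p] R 0 := by simpa using h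
    have := hinj this
    exact (pow_ne_zero i (by exact_mod_cast (Fact.out : p.Prime).ne_zero)) this
  have key : ∀ i j : ℕ, i < j → i < k →
      (p : R) ^ i - (p : R) ^ j ∉ Ideal.span {(p : R) ^ k} := by
    intro i j hij hik h
    obtain ⟨a, ha⟩ := Ideal.mem_span_singleton'.1 h
    obtain ⟨s, rfl⟩ := Nat.exists_eq_add_of_lt hij
    obtain ⟨t, rfl⟩ := Nat.exists_eq_add_of_lt hik
    have : (p : R) ^ i * (1 - p * (p ^ s + a * p ^ t)) = 0 := by
      linear_combination -ha
    rw [(hunit _).mul_left_eq_zero] at this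
    exact hne i this
  have hin : Function.Injective
      (fun i : Fin k => Ideal.Quotient.mk (Ideal.span {(p : R) ^ k}) ((p : R) ^ i.val)) := by
    intro i j h
    have h' : Ideal.Quotient.mk (Ideal.span {(p : R) ^ k}) ((p : R) ^ i.val) = 
      Ideal.Quotient.mk (Ideal.span {(p : R) ^ k}) ((p : R) ^ j.val) := h
    rcases lt_trichotomy i j with hl | hl | hl
    · exact absurd (Ideal.Quotient.eq.1 h') (key _ _ hl i.2)
    · exact hl
    · exact absurd (Ideal.Quotient.eq.1 h'.symm) (key _ _ hl j.2)
  simpa using Nat.card_le_card_of_injective _ hin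

lemma aux_torsion (M : Type) [AddCommGroup M] [Module R M] [Finite M] :
    ∃ e : ℕ, ∀ x : M, (p : R) ^ e • x = 0 := by
  obtain ⟨e, n, hn, hc⟩ := Nat.exists_eq_pow_mul_and_not_dvd (n := Nat.card M)
    Nat.card_pos.ne' p (Fact.out : p.Prime).ne_one
  refine ⟨e, fun x => ?_⟩
  have hu : IsUnit (n : ℤ_[p]) := by
    rw [PadicInt.isUnit_iff, PadicInt.norm_natCast_eq_one_iff]
    exact (Nat.Prime.coprime_iff_not_dvd Fact.out).2 hn
  have hu' : IsUnit (n : R) := by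
    have := hu.map (algebraMap ℤ_[p] R)
    simpa using this
  have h : (Nat.card M : R) • x = 0 := by
    rw [Nat.cast_smul_eq_nsmul]; exact card_nsmul_eq_zero'
  rw [hc] at h
  push_cast at h
  rw [mul_comm, mul_smul] at h
  exact (hu'.smul_eq_zero).1 h

lemma aux_not_occ (M : Type) [AddCommGroup M] [Module R M] (hocc : ¬ OccursAsCokernel R M)
    (k : ℕ) (hk : ∀ x : M, (p : R) ^ k • x = 0) (N : ℕ) (hN : 0 < N)
    (G : Module.End (R ⧸ Ideal.span {(p : R) ^ (k + 1)})
      (Fin N → R ⧸ Ideal.span {(p : R) ^ (k + 1)}))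
    (e : ((Fin N → R ⧸ Ideal.span {(p : R) ^ (k + 1)}) ⧸ LinearMap.range G) ≃ₗ[R] M) : False := by
  apply hocc
  have hnoeth : IsNoetherianRing R := IsNoetherianRing.of_finite ℤ_[p] R
  set A := R ⧸ Ideal.span {(p : R) ^ (k + 1)} with hA
  let π : (Fin N → R) →ₗ[R] (Fin N → A) := (Algebra.linearMap R A).compLeft (Fin N)
  have hs : Function.Surjective (algebraMap R A) := Ideal.Quotient.mk_surjective
  have hπ : Function.Surjective π := hs.comp_left
  let φ : (Fin N → R) →ₗ[R] M := (e : _ →ₗ[R] M) ∘ₗ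
    ((LinearMap.range G).mkQ.restrictScalars R) ∘ₗ π
  have hφ : Function.Surjective φ :=
    e.surjective.comp ((Submodule.mkQ_surjective (LinearMap.range G)).comp hπ)
  obtain ⟨H, hH⟩ := Module.projective_lifting_property π ((G.restrictScalars R) ∘ₗ π) hπ
  have hH' : ∀ x, π (H x) = G (π x) := fun x => LinearMap.congr_fun hH x
  have hφk : ∀ x, φ x = 0 ↔ π x ∈ LinearMap.range G := by
    intro x
    simp [φ]
  have hle : LinearMap.range H ≤ LinearMap.ker φ := by
    rintro _ ⟨x, rfl⟩
    rw [LinearMap.mem_ker, hφk, hH']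
    exact ⟨_, rfl⟩
  have hge : LinearMap.ker φ ≤ LinearMap.range H := by
    refine Submodule.le_of_le_smul_of_le_jacobson_bot (I := maximalIdeal R)
      (IsNoetherian.noetherian _) (maximalIdeal_le_jacobson _) ?_
    intro x hx
    rw [LinearMap.mem_ker, hφk] at hx
    obtain ⟨y, hy⟩ := hx
    obtain ⟨z, rfl⟩ := hπ y
    rw [← hH'] at hy
    have hd : ∀ i, ∃ a : R, (x - H z) i = p ^ (k + 1) * a := by
      intro i
      have h1 : Ideal.Quotient.mk (Ideal.span {(p : R) ^ (k + 1)}) (x i) =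
        Ideal.Quotient.mk (Ideal.span {(p : R) ^ (k + 1)}) (H z i) := (congrFun hy i).symm
      obtain ⟨a, ha⟩ := Ideal.mem_span_singleton'.1 (Ideal.Quotient.eq.1 h1)
      exact ⟨a, by rw [Pi.sub_apply, ← ha, mul_comm]⟩
    choose a ha using hd
    have h2 : x = H z + (p : R) • ((p : R) ^ k • a) := by
      rw [← sub_eq_iff_eq_add']
      ext i
      rw [ha]
      simp only [Pi.smul_apply, smul_eq_mul]
      ring
    rw [h2]
    refine Submodule.add_mem_sup ⟨z, rfl⟩ (Submodule.smul_mem_smul (aux_p_mem p R) ?_)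
    rw [LinearMap.mem_ker, map_smul, hk]
  exact ⟨N, hN, H, ⟨(Submodule.quotEquivOfEq _ _ (le_antisymm hle hge)).trans
    (φ.quotKerEquivOfSurjective hφ)⟩⟩

lemma aux_occ (hinj : Function.Injective (algebraMap ℤ_[p] R))
    (M : Type) [AddCommGroup M] [Module R M] [Finite M] (hocc : OccursAsCokernel R M)
    (k : ℕ) (hk : ∀ x : M, (p : R) ^ k • x = 0) (hk' : Nat.card M < k) (N : ℕ) :
    levelProportion p R N k M = auxFormula R M N := by
  have hM : Module.IsTorsionBySet R M (Ideal.span {(p : R) ^ k}) := by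
    rw [Module.isTorsionBySet_span_singleton_iff]
    intro x; exact hk x
  letI := hM.module
  haveI : IsScalarTower R (R ⧸ Ideal.span {(p : R) ^ k}) M := hM.isScalarTower
  have := aux_finite_level p R k
  have hc := hk'.trans_le (aux_card_level p R hinj k)
  have hne : Nontrivial (R ⧸ Ideal.span {(p : R) ^ k}) := by
    rw [← Finite.one_lt_card_iff_nontrivial]
    have : 0 < Nat.card M := Nat.card_pos
    omega
  have hs : Function.Surjective (algebraMap R (R ⧸ Ideal.span {(p : R) ^ k})) :=
    Ideal.Quotient.mk_surjective
  have : IsLocalRing (R ⧸ Ideal.span {(p : R) ^ k}) := IsLocalRing.of_surjective' _ hs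
  exact aux_level hs hc hocc N

end

lemma aux_span_le {R M : Type} [CommRing R] [AddCommGroup M] [Module R M] [Finite M] (N : ℕ) :
    Nat.card M ^ N ≤ Nat.card {v : Fin N → M // Submodule.span R (Set.range v) = ⊤} +
      ∑ᶠ H : {H : Submodule R M // H ≠ ⊤}, Nat.card H.1 ^ N := by
  classical
  have : Fintype {H : Submodule R M // H ≠ ⊤} := Fintype.ofFinite _
  rw [finsum_eq_sum_of_fintype]
  have h1 : Nat.card (Fin N → M) = Nat.card M ^ N := by rw [Nat.card_fun, Nat.card_fin]
  have h2 : ∑ H : {H : Submodule R M // H ≠ ⊤}, Nat.card H.1 ^ N =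
      Nat.card (Σ H : {H : Submodule R M // H ≠ ⊤}, Fin N → H.1) := by
    rw [Nat.card_sigma]
    refine Finset.sum_congr rfl fun H _ => ?_
    rw [Nat.card_fun, Nat.card_fin]
  rw [← h1, h2, ← Nat.card_sum]
  let f : ({v : Fin N → M // Submodule.span R (Set.range v) = ⊤} ⊕
    (Σ H : {H : Submodule R M // H ≠ ⊤}, Fin N → H.1)) → (Fin N → M) :=
    Sum.elim Subtype.val (fun x i => (x.2 i : M))
  refine Nat.card_le_card_of_surjective f ?_
  intro v
  by_cases hv : Submodule.span R (Set.range v) = ⊤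
  · exact ⟨Sum.inl ⟨v, hv⟩, rfl⟩
  · exact ⟨Sum.inr ⟨⟨_, hv⟩, fun i => ⟨v i, Submodule.subset_span ⟨i, rfl⟩⟩⟩, rfl⟩

lemma aux_span_lim (R M : Type) [CommRing R] [AddCommGroup M] [Module R M] [Finite M] :
    Tendsto (fun N : ℕ => (Nat.card {v : Fin N → M // Submodule.span R (Set.range v) = ⊤} : ℝ) /
      (Nat.card M : ℝ) ^ N) atTop (nhds 1) := by
  classical
  have : Fintype {H : Submodule R M // H ≠ ⊤} := Fintype.ofFinite _
  have hM : (0 : ℝ) < Nat.card M := by exact_mod_cast Nat.card_pos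
  have hlow : Tendsto (fun N : ℕ => 1 - ∑ H : {H : Submodule R M // H ≠ ⊤},
      ((Nat.card H.1 : ℝ) / Nat.card M) ^ N) atTop (nhds 1) := by
    have : Tendsto (fun N : ℕ => ∑ H : {H : Submodule R M // H ≠ ⊤},
      ((Nat.card H.1 : ℝ) / Nat.card M) ^ N) atTop
      (nhds (∑ H : {H : Submodule R M // H ≠ ⊤}, 0)) := by
      refine tendsto_finsetSum _ fun H _ => ?_
      refine tendsto_pow_atTop_nhds_zero_of_lt_one (by positivity) ?_
      rw [div_lt_one hM]
      have hlt : Nat.card H.1 < Nat.card M := by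
        refine lt_of_le_of_ne (Nat.card_le_card_of_injective _ H.1.injective_subtype) fun h => ?_
        apply H.2
        have hb := (Nat.bijective_iff_injective_and_card H.1.subtype).2 ⟨H.1.injective_subtype, h⟩
        rw [← H.1.range_subtype]
        exact LinearMap.range_eq_top.2 hb.2
      exact_mod_cast hlt
    simpa using this.const_sub 1
  refine tendsto_of_tendsto_of_tendsto_of_le_of_le hlow tendsto_const_nhds ?_ ?_
  · intro N
    have := aux_span_le (R := R) (M := M) N
    rw [finsum_eq_sum_of_fintype] at this
    have h := (Nat.cast_le (α := ℝ)).2 this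
    push_cast at h
    simp only [div_pow]
    rw [← Finset.sum_div, sub_le_iff_le_add, ← add_div, le_div_iff₀ (by positivity), one_mul]
    exact h
  · intro N
    simp only
    rw [div_le_one (by positivity)]
    have := Nat.card_le_card_of_injective
      (Subtype.val : {v : Fin N → M // Submodule.span R (Set.range v) = ⊤} → _)
      Subtype.val_injective
    rw [Nat.card_fun, Nat.card_fin] at this
    exact_mod_cast this

lemma aux_formula_lim (R M : Type) [CommRing R] [IsLocalRing R] [Finite (ResidueField R)]
    [AddCommGroup M] [Module R M] [Finite M] :
    Tendsto (auxFormula R M) atTop (nhds (cConst R / (numAut R M : ℝ))) := by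
  have hq : (1 : ℝ) < Nat.card (ResidueField R) := by exact_mod_cast Finite.one_lt_card
  have hmul : Multipliable fun i : ℕ => (1 - ((Nat.card (ResidueField R) : ℝ))⁻¹ ^ (i + 1)) := by
    have := multipliable_one_add_of_summable
      (f := fun i : ℕ => - ((Nat.card (ResidueField R) : ℝ))⁻¹ ^ (i + 1)) ?_
    · simpa [sub_eq_add_neg] using this
    · have hs := (summable_nat_add_iff 1).2 (summable_geometric_of_lt_one
        (r := ((Nat.card (ResidueField R) : ℝ))⁻¹) (by positivity) (inv_lt_one_of_one_lt₀ hq))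
      simpa using hs
  have h := ((aux_span_lim R M).mul hmul.hasProd.tendsto_prod_nat).div_const (numAut R M : ℝ)
  rw [one_mul] at h
  exact h

theorem statement4 (p : ℕ) [Fact p.Prime] (R : Type) [CommRing R] [IsLocalRing R]
    [Algebra ℤ_[p] R] (hinj : Function.Injective (algebraMap ℤ_[p] R))
    [Module.Finite ℤ_[p] R] [Finite (ResidueField R)]
    (M : Type) [AddCommGroup M] [Module R M] [Finite M] :
    (OccursAsCokernel R M →
      Tendsto (fun N => muRN p R N M) atTop (nhds (cConst R / (numAut R M : ℝ)))) ∧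
    (¬ OccursAsCokernel R M → ∀ N : ℕ, 0 < N → muRN p R N M = 0) := by
  obtain ⟨e, he⟩ := aux_torsion p R M
  have he' : ∀ k, e ≤ k → ∀ x : M, (p : R) ^ k • x = 0 := by
    intro k hk x
    obtain ⟨t, rfl⟩ := Nat.exists_eq_add_of_le hk
    rw [pow_add, mul_comm, mul_smul, he, smul_zero]
  constructor
  · intro hocc
    have : (fun N => muRN p R N M) = auxFormula R M := by
      funext N
      refine Tendsto.limUnder_eq (tendsto_const_nhds.congr' ?_)
      filter_upwards [eventually_ge_atTop (e + Nat.card M + 1)] with k hk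
      exact (aux_occ p R hinj M hocc k (he' k (by omega)) (by omega) N).symm
    rw [this]
    exact aux_formula_lim R M
  · intro hocc N hN
    refine Tendsto.limUnder_eq (tendsto_const_nhds.congr' ?_)
    filter_upwards [eventually_ge_atTop (e + 1)] with k hk
    obtain ⟨k, rfl⟩ : ∃ j, k = j + 1 := ⟨k - 1, by omega⟩
    have : IsEmpty {G : Module.End (R ⧸ Ideal.span {(p : R) ^ (k + 1)})
        (Fin N → R ⧸ Ideal.span {(p : R) ^ (k + 1)}) //
        Nonempty (((Fin N → R ⧸ Ideal.span {(p : R) ^ (k + 1)}) ⧸ LinearMap.range G) ≃ₗ[R] M)} :=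
      ⟨fun G => aux_not_occ p R M hocc k (he' k (by omega)) N hN G.1 G.2.some⟩
    rw [levelProportion, Nat.card_of_isEmpty]
    simp
end

section
/- The sum of 1/#Aut_R(M) over all isomorphism classes of finite R-modules M which occur as a cokernel (equivalently, with d_M = 0) converges and equals c_R^{−1} = ∏_{i=1}^∞ (1 − |F_R|^{−i})^{−1}. -/
/- STATEMENT 5: The sum of 1/#Aut_R(M) over all isomorphism classes of finite R-modules
   M which occur as a cokernel converges and equals
   c_R^{−1} = ∏_{i=1}^∞ (1 − |F_R|^{−i})^{−1}.

   The sum over isomorphism classes is expressed by summing over any complete,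
   irredundant family of representatives of the isomorphism classes of finite R-modules
   occurring as cokernels. -/

open IsLocalRing

noncomputable def wt (q N r : ℕ) : ℝ := ∏ i ∈ Finset.range r, (1 - (q:ℝ)⁻¹ ^ (N - i))

lemma span_iff_li {F : Type} [Field F] (N r : ℕ) (v : Fin N → Fin r → F) :
    Submodule.span F (Set.range v) = ⊤ ↔ LinearIndependent F (fun j i => v i j) := by
  rw [linearIndependent_iff_card_eq_finrank_span]
  have h1 := (Matrix.of v).rank_eq_finrank_span_row
  have h2 := (Matrix.of v).transpose.rank_eq_finrank_span_row
  rw [Matrix.rank_transpose] at h2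
  have e1 : (Matrix.of v).row = v := rfl
  have e2 : (Matrix.of v).transpose.row = (fun j i => v i j) := rfl
  rw [e1] at h1
  rw [e2] at h2
  unfold Set.finrank
  rw [← h2, h1]
  constructor
  · intro h
    rw [h]; simp
  · intro h
    apply Submodule.eq_top_of_finrank_eq
    rw [← h]; simp

lemma card_span_fin {F : Type} [Field F] [Finite F] (N r : ℕ) :
    (Nat.card {v : Fin N → Fin r → F // Submodule.span F (Set.range v) = ⊤} : ℝ)
      = ((Nat.card F : ℝ) ^ r) ^ N * wt (Nat.card F) N r := by
  classical
  have := Fintype.ofFinite F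
  let e : {v : Fin N → Fin r → F // Submodule.span F (Set.range v) = ⊤} ≃
      {s : Fin r → (Fin N → F) // LinearIndependent F s} :=
    (Equiv.piComm (fun _ _ => F)).subtypeEquiv (fun v => span_iff_li N r v)
  rw [Nat.card_congr e]
  have hq : 1 < Nat.card F := Finite.one_lt_card
  by_cases hr : r ≤ N
  · rw [card_linearIndependent (by simpa using hr), ← Nat.card_eq_fintype_card]
    rw [wt, ← pow_mul, mul_comm r N, pow_mul, Finset.prod_range,
      show (((Nat.card F : ℝ) ^ N) ^ r) = ∏ _i : Fin r, ((Nat.card F : ℝ) ^ N) by simp,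
      ← Finset.prod_mul_distrib]
    push_cast
    apply Finset.prod_congr rfl
    intro i _
    have hi : (i:ℕ) ≤ N := by omega
    simp only [Module.finrank_fintype_fun_eq_card, Fintype.card_fin]
    rw [Nat.cast_sub (Nat.pow_le_pow_right (by omega) hi)]
    push_cast
    have h0 : (Nat.card F : ℝ) ≠ 0 := by positivity
    obtain ⟨d, hd⟩ := Nat.exists_eq_add_of_le hi
    rw [show N - (i:ℕ) = d by omega, hd, pow_add, mul_sub, mul_one, mul_assoc, ← mul_pow, mul_inv_cancel₀ h0]
    simp
  · have : IsEmpty {s : Fin r → (Fin N → F) // LinearIndependent F s} := by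
      constructor
      rintro ⟨s, hs⟩
      have := hs.fintype_card_le_finrank
      simp at this
      omega
    rw [Nat.card_of_isEmpty, wt, Finset.prod_eq_zero (i := N) (by simp; omega)] <;> simp

lemma card_span_field {F : Type} [Field F] [Finite F] {W : Type} [AddCommGroup W] [Module F W]
    [Module.Finite F W] (N : ℕ) :
    (Nat.card {v : Fin N → W // Submodule.span F (Set.range v) = ⊤} : ℝ)
      = (Nat.card W : ℝ) ^ N * wt (Nat.card F) N (Module.finrank F W) := by
  let b := Module.finBasis F W
  have e : {v : Fin N → W // Submodule.span F (Set.range v) = ⊤} ≃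
    {v : Fin N → Fin (Module.finrank F W) → F // Submodule.span F (Set.range v) = ⊤} :=
    (Equiv.piCongrRight (fun _ => b.equivFun.toEquiv)).subtypeEquiv (by
      intro v
      have : Set.range ((Equiv.piCongrRight (fun _ : Fin N => b.equivFun.toEquiv)) v)
        = b.equivFun '' Set.range v := by
        rw [← Set.range_comp]; rfl
      have h2 := Submodule.map_span b.equivFun.toLinearMap (Set.range v)
      rw [LinearEquiv.coe_coe] at h2
      rw [this, ← h2]
      have h3 : Submodule.map b.equivFun.toLinearMap ⊤ = ⊤ := by
        rw [Submodule.map_top]; exact LinearEquiv.range _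
      constructor
      · intro h; rw [h, h3]
      · intro h
        exact Submodule.map_injective_of_injective b.equivFun.injective (h.trans h3.symm))
  rw [Nat.card_congr e, card_span_fin, Module.natCard_eq_pow_finrank (K := F) (V := W)]
  push_cast
  rfl

lemma card_span_local {R : Type} [CommRing R] [IsLocalRing R] [Finite (ResidueField R)]
    {M : Type} [AddCommGroup M] [Module R M] [Finite M] (N : ℕ) :
    (Nat.card {v : Fin N → M // Submodule.span R (Set.range v) = ⊤} : ℝ)
      = (Nat.card M : ℝ) ^ N * wt (Nat.card (ResidueField R)) N
        (Module.finrank (ResidueField R) (TensorProduct R (ResidueField R) M)) := by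
  let F := ResidueField R
  let W := TensorProduct R F M
  let f : M →ₗ[R] W := TensorProduct.mk R F M 1
  have hf : Function.Surjective f := TensorProduct.mk_surjective R M F Ideal.Quotient.mk_surjective
  have : Finite W := Finite.of_surjective f hf
  have : Module.Finite F W := Module.Finite.of_finite
  have hiff : ∀ v : Fin N → M, Submodule.span R (Set.range v) = ⊤ ↔
      Submodule.span F (Set.range (f ∘ v)) = ⊤ := by
    intro v
    rw [← IsLocalRing.map_tensorProduct_mk_eq_top, Submodule.map_span, ← Submodule.restrictScalars_span R F
      Ideal.Quotient.mk_surjective, Submodule.restrictScalars_eq_top_iff, Set.range_comp]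
  -- fibers
  have hfib : ∀ g : Fin N → W, Nat.card {v : Fin N → M // f ∘ v = g} = Nat.card (LinearMap.ker f) ^ N := by
    intro g
    choose s hs using fun i => hf (g i)
    have hc : Nat.card (LinearMap.ker f) ^ N = Nat.card (Fin N → LinearMap.ker f) := by
      rw [Nat.card_fun, Nat.card_fin]
    rw [hc]
    refine Nat.card_congr ⟨fun v i => ⟨v.1 i - s i, ?_⟩, fun u => ⟨fun i => u i + s i, ?_⟩, ?_, ?_⟩
    · have := congrFun v.2 i
      simp only [Function.comp] at this
      simp [this, hs]
    · ext i
      have := (u i).2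
      simp only [LinearMap.mem_ker] at this
      simp [this, hs]
    · intro v; ext i; simp
    · intro u; ext i; simp
  have hM : Nat.card M = Nat.card (LinearMap.ker f) * Nat.card W := by
    have := Submodule.card_eq_card_quotient_mul_card (LinearMap.ker f)
    rw [this, Nat.card_congr (f.quotKerEquivOfSurjective hf).toEquiv]
  let e : {v : Fin N → M // Submodule.span R (Set.range v) = ⊤} ≃
      Σ g : {g : Fin N → W // Submodule.span F (Set.range g) = ⊤}, {v : Fin N → M // f ∘ v = g.1} :=
    ⟨fun v => ⟨⟨f ∘ v.1, (hiff _).1 v.2⟩, ⟨v.1, rfl⟩⟩, fun x => ⟨x.2.1, (hiff _).2 (by rw [x.2.2]; exact x.1.2)⟩,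
      fun v => rfl, by
        rintro ⟨⟨g, hg⟩, ⟨v, hv⟩⟩
        change f ∘ v = g at hv
        subst hv
        rfl⟩
  classical
  have := Fintype.ofFinite {g : Fin N → W // Submodule.span F (Set.range g) = ⊤}
  rw [Nat.card_congr e, Nat.card_sigma]
  simp only [hfib]
  rw [Finset.sum_const, Finset.card_univ, ← Nat.card_eq_fintype_card, smul_eq_mul]
  push_cast
  rw [card_span_field, hM]
  push_cast
  ring

lemma schanuel {R : Type} [CommRing R] [IsLocalRing R] [IsNoetherianRing R]
    {M : Type} [AddCommGroup M] [Module R M] (hM : OccursAsCokernel R M) (N : ℕ)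
    (φ : (Fin N → R) →ₗ[R] M) (hφ : Function.Surjective φ) :
    Module.finrank (ResidueField R) (TensorProduct R (ResidueField R) (LinearMap.ker φ)) ≤ N := by
  obtain ⟨N0, -, G, ⟨e⟩⟩ := hM
  let φ0 : (Fin N0 → R) →ₗ[R] M := e.toLinearMap ∘ₗ (LinearMap.range G).mkQ
  have hφ0 : Function.Surjective φ0 := e.surjective.comp (Submodule.mkQ_surjective _)
  have hker : ∀ y, φ0 y = 0 → ∃ z, G z = y := by
    intro y hy
    have : (LinearMap.range G).mkQ y = 0 := e.injective (by simpa [φ0] using hy)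
    simpa using this
  have hG : ∀ z, φ0 (G z) = 0 := by
    intro z
    have : (LinearMap.range G).mkQ (G z) = 0 := by simp
    simp only [φ0, LinearMap.comp_apply, this, map_zero]
  obtain ⟨a, ha⟩ := Module.projective_lifting_property φ0 φ hφ0
  obtain ⟨b, hb⟩ := Module.projective_lifting_property φ φ0 hφ
  have ha' : ∀ x, φ0 (a x) = φ x := fun x => by rw [← ha]; rfl
  have hb' : ∀ x, φ (b x) = φ0 x := fun x => by rw [← hb]; rfl
  let y : ((Fin N → R) × (Fin N0 → R)) →ₗ[R] (Fin N0 → R) := LinearMap.coprod a G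
  let x : ((Fin N → R) × (Fin N0 → R)) →ₗ[R] (Fin N → R) := LinearMap.fst R _ _ - b ∘ₗ y
  have hx : ∀ u, x u ∈ LinearMap.ker φ := by
    intro u
    simp [x, y, hb', ha', hG]
  let Ψ : ((Fin N → R) × (Fin N0 → R)) →ₗ[R] (LinearMap.ker φ × (Fin N0 → R)) :=
    LinearMap.prod (x.codRestrict _ hx) y
  have hΨ : Function.Surjective Ψ := by
    rintro ⟨⟨κ, hκ⟩, w⟩
    have hκ' : φ κ = 0 := hκ
    obtain ⟨z, hz⟩ := hker (w - a (κ + b w)) (by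
      rw [map_sub, ha', map_add, hb', hκ']; simp)
    refine ⟨(κ + b w, z), ?_⟩
    have hy : y (κ + b w, z) = w := by
      simp only [y, LinearMap.coprod_apply]
      rw [hz]; abel
    refine Prod.ext (Subtype.ext ?_) hy
    change x (κ + b w, z) = κ
    simp only [x, LinearMap.sub_apply, LinearMap.comp_apply, hy, LinearMap.fst_apply]
    abel
  let F := ResidueField R
  have hs : Function.Surjective (Ψ.baseChange F) := LinearMap.lTensor_surjective F hΨ
  have h1 := LinearMap.finrank_le_finrank_of_surjective hs
  have h2 : Module.finrank F (TensorProduct R F (Fin N0 → R)) = N0 := by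
    rw [Module.finrank_baseChange]; simp
  have h3 : Module.finrank F (TensorProduct R F ((Fin N → R) × (Fin N0 → R))) = N + N0 := by
    rw [Module.finrank_baseChange]; simp
  rw [LinearEquiv.finrank_eq (TensorProduct.prodRight R F F (LinearMap.ker φ) (Fin N0 → R))] at h1
  rw [Module.finrank_prod, h2, h3] at h1
  exact Nat.le_of_add_le_add_right h1

lemma gens_lower {R : Type} [CommRing R] [IsLocalRing R] (ϖ : R) (hϖ : ϖ ∈ maximalIdeal R)
    (hnil : ∀ j : ℕ, ϖ ^ j ≠ 0) (N k : ℕ) {V : Type} [AddCommGroup V] [Module R V] [Finite V]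
    (π : (Fin N → R) →ₗ[R] V) 
    (hker : ∀ x, π x = 0 → ∃ y, x = ϖ ^ (k + 1) • y)
    (K : Submodule R (Fin N → R)) (hK : ∀ x, ϖ ^ k • x ∈ K) :
    N ≤ Module.finrank (ResidueField R) (TensorProduct R (ResidueField R) (K.map π)) := by
  by_contra hlt
  push Not at hlt
  let F := ResidueField R
  let W := TensorProduct R F (K.map π)
  let f : (K.map π) →ₗ[R] W := TensorProduct.mk R F (K.map π) 1
  have hf : Function.Surjective f := TensorProduct.mk_surjective R _ F Ideal.Quotient.mk_surjective
  have : Finite W := Finite.of_surjective f hf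
  have : Module.Finite F W := Module.Finite.of_finite
  let b := Module.finBasis F W
  choose h hh using fun i => hf (b i)
  have hspan := IsLocalRing.span_eq_top_of_tmul_eq_basis h b hh
  have hl : ∀ i, ∃ x ∈ K, π x = h i := fun i => (h i).2
  choose x hxK hx using hl
  -- ϖ^k R^N ≤ span x
  have hW : (⊤ : Submodule R (Fin N → R)).map (LinearMap.lsmul R _ (ϖ ^ k)) ≤ Submodule.span R (Set.range x) := by
    apply Submodule.le_of_le_smul_of_le_jacobson_bot (I := maximalIdeal R)
    · exact Submodule.FG.map _ Module.Finite.fg_top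
    · rw [IsLocalRing.jacobson_eq_maximalIdeal _ bot_ne_top]
    · rintro _ ⟨u, -, rfl⟩
      have hu : ϖ ^ k • u ∈ K := hK u
      have h1 : (⟨π (ϖ ^ k • u), Submodule.mem_map_of_mem hu⟩ : K.map π) ∈ Submodule.span R (Set.range h) := by
        rw [hspan]; trivial
      rw [Submodule.mem_span_range_iff_exists_fun] at h1
      obtain ⟨c, hc⟩ := h1
      have hc' : π (∑ i, c i • x i) = π (ϖ ^ k • u) := by
        have := congrArg Subtype.val hc
        simp only [map_sum, map_smul, hx]
        simp only [AddSubmonoidClass.coe_finsetSum, Submodule.coe_smul] at this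
        rw [this, map_smul]
      obtain ⟨y, hy⟩ := hker (ϖ ^ k • u - ∑ i, c i • x i) (by rw [map_sub, hc', sub_self])
      change ϖ ^ k • u ∈ _
      rw [← add_sub_cancel (∑ i, c i • x i) (ϖ ^ k • u)]
      apply Submodule.add_mem_sup
      · exact Submodule.sum_mem _ fun i _ => Submodule.smul_mem _ _ (Submodule.subset_span ⟨i, rfl⟩)
      · rw [hy, pow_succ', mul_smul]
        apply Submodule.smul_mem_smul hϖ
        exact ⟨y, trivial, rfl⟩
  let H : Fin N → Fin N → R := fun j => if hj : j.1 < Module.finrank F W then x ⟨j.1, hj⟩ else 0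
  have hH : ∀ i, ∃ c : Fin N → R, ∑ j, c j • H j = ϖ ^ k • Pi.single i 1 := by
    intro i
    rw [← Submodule.mem_span_range_iff_exists_fun]
    refine Submodule.span_mono ?_ (hW ⟨Pi.single i 1, trivial, rfl⟩)
    rintro _ ⟨j, rfl⟩
    exact ⟨⟨j.1, j.2.trans hlt⟩, by simp [H]⟩
  choose c hc using hH
  have hmat : Matrix.of c * Matrix.of H = ϖ ^ k • (1 : Matrix (Fin N) (Fin N) R) := by
    ext i j
    have := congrFun (hc i) j
    simp only [Finset.sum_apply, Pi.smul_apply, smul_eq_mul] at this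
    simp only [Matrix.mul_apply, Matrix.of_apply, this, Matrix.smul_apply, smul_eq_mul, Matrix.one_apply, Pi.single_apply, eq_comm]
  have hdet := congrArg Matrix.det hmat
  rw [Matrix.det_mul, Matrix.det_smul, Matrix.det_one, mul_one, 
    Matrix.det_eq_zero_of_row_eq_zero (A := Matrix.of H) ⟨_, hlt⟩ (by intro j; simp [H, W, F]), mul_zero, ← pow_mul] at hdet
  exact hnil _ hdet.symm

noncomputable def Lg {R V : Type} [CommRing R] [AddCommGroup V] [Module R V] {N : ℕ}
    (π : (Fin N → R) →ₗ[R] V) (g : Fin N → V) : Submodule R (Fin N → R) :=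
  (Submodule.span R (Set.range g)).comap π

lemma card_surj {R : Type} [CommRing R] [IsLocalRing R] [Finite (ResidueField R)]
    {M : Type} [AddCommGroup M] [Module R M] [Finite M] (N : ℕ) :
    (Nat.card {φ : (Fin N → R) →ₗ[R] M // Function.Surjective φ} : ℝ)
      = (Nat.card M : ℝ) ^ N * wt (Nat.card (ResidueField R)) N
        (Module.finrank (ResidueField R) (TensorProduct R (ResidueField R) M)) := by
  rw [← card_span_local]
  congr 1
  symm
  refine Nat.card_congr (((Pi.basisFun R (Fin N)).constr R).toEquiv.subtypeEquiv ?_)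
  intro v
  rw [← LinearMap.range_eq_top]
  change _ ↔ LinearMap.range (((Pi.basisFun R (Fin N)).constr R) v) = ⊤
  rw [Module.Basis.constr_range]

lemma card_iso {R : Type} [CommRing R] {A M : Type} [AddCommGroup M] [Module R M]
    [AddCommGroup A] [Module R A] (L : Submodule R A) (e : (A ⧸ L) ≃ₗ[R] M) :
    Nat.card {φ : A →ₗ[R] M // Function.Surjective φ ∧ LinearMap.ker φ = L} = numAut R M := by
  symm
  have hk : ∀ α : M ≃ₗ[R] M, LinearMap.ker (α.toLinearMap ∘ₗ e.toLinearMap ∘ₗ L.mkQ) = L := by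
    intro α
    ext x
    simp
  refine Nat.card_eq_of_bijective (fun α : M ≃ₗ[R] M => ⟨α.toLinearMap ∘ₗ e.toLinearMap ∘ₗ L.mkQ,
    α.surjective.comp (e.surjective.comp L.mkQ_surjective), hk α⟩) ⟨?_, ?_⟩
  · intro α β h
    ext m
    obtain ⟨x, rfl⟩ := (e.surjective.comp L.mkQ_surjective) m
    exact LinearMap.congr_fun (congrArg Subtype.val h) x
  · rintro ⟨φ, hs, hker⟩
    subst hker
    refine ⟨e.symm.trans (φ.quotKerEquivOfSurjective hs), ?_⟩
    ext x
    simp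

lemma count {R : Type} [CommRing R] [IsLocalRing R] [IsNoetherianRing R] [Finite (ResidueField R)]
    (ϖ : R) (hϖ : ϖ ∈ maximalIdeal R)
    (hnil : ∀ j : ℕ, ϖ ^ j ≠ 0) (N k : ℕ) {V : Type} [AddCommGroup V] [Module R V] [Finite V]
    (π : (Fin N → R) →ₗ[R] V) (hπ : Function.Surjective π)
    (hker : ∀ x, π x = 0 ↔ ∃ y, x = ϖ ^ (k + 1) • y)
    {M : Type} [AddCommGroup M] [Module R M] [Finite M] (hM : OccursAsCokernel R M)
    (hkM : ∀ m : M, ϖ ^ k • m = 0) :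
    (Nat.card {g : Fin N → V // Nonempty (((Fin N → R) ⧸ Lg π g) ≃ₗ[R] M)} : ℝ) * numAut R M
      = (Nat.card V : ℝ) ^ N * (wt (Nat.card (ResidueField R)) N
        (Module.finrank (ResidueField R) (TensorProduct R (ResidueField R) M))
        * wt (Nat.card (ResidueField R)) N N) := by
  have hfinHom : Finite ((Fin N → R) →ₗ[R] M) :=
    Finite.of_equiv _ ((Pi.basisFun R (Fin N)).constr R (M' := M)).toEquiv
  let S := {φ : (Fin N → R) →ₗ[R] M // Function.Surjective φ}
  let Gd := {g : Fin N → V // Nonempty (((Fin N → R) ⧸ Lg π g) ≃ₗ[R] M)}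
  let T1 := Σ g : Gd, {φ : (Fin N → R) →ₗ[R] M // Function.Surjective φ ∧ LinearMap.ker φ = Lg π g.1}
  let T2 := Σ φ : S, {g : Fin N → V // LinearMap.ker φ.1 = Lg π g}
  let e : T1 ≃ T2 := ⟨fun x => ⟨⟨x.2.1, x.2.2.1⟩, ⟨x.1.1, x.2.2.2⟩⟩,
    fun x => ⟨⟨x.2.1, ⟨(Submodule.quotEquivOfEq _ _ x.2.2.symm).trans
      (x.1.1.quotKerEquivOfSurjective x.1.2)⟩⟩, ⟨x.1.1, x.1.2, x.2.2⟩⟩, fun _ => rfl, fun _ => rfl⟩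
  have := Fintype.ofFinite Gd
  have := Fintype.ofFinite S
  have h1 : Nat.card T1 = Nat.card Gd * numAut R M := by
    rw [Nat.card_sigma, Finset.sum_congr rfl (fun g _ => card_iso (Lg π g.1) g.2.some)]
    simp
  have hkerφ : ∀ φ : (Fin N → R) →ₗ[R] M, LinearMap.ker π ≤ LinearMap.ker φ := by
    intro φ x hx
    obtain ⟨y, rfl⟩ := (hker x).1 hx
    rw [LinearMap.mem_ker, map_smul, pow_succ', mul_smul, hkM, smul_zero]
  have hfib : ∀ φ : S, (Nat.card {g : Fin N → V // LinearMap.ker φ.1 = Lg π g} : ℝ) =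
      (Nat.card V / Nat.card M : ℝ) ^ N * wt (Nat.card (ResidueField R)) N N := by
    rintro ⟨φ, hφ⟩
    change (Nat.card {g : Fin N → V // LinearMap.ker φ = Lg π g} : ℝ) = _
    let K := (LinearMap.ker φ).map π
    have hcom : K.comap π = LinearMap.ker φ := by
      rw [Submodule.comap_map_eq, sup_eq_left.2 (hkerφ φ)]
    have hspan : ∀ v : Fin N → K, Submodule.span R (Set.range fun i => (v i : V)) =
        (Submodule.span R (Set.range v)).map K.subtype := by
      intro v
      rw [Submodule.map_span, ← Set.range_comp]; rfl
    have hgK : ∀ g : Fin N → V, LinearMap.ker φ = Lg π g → Submodule.span R (Set.range g) = K := by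
      intro g hg
      change _ = (LinearMap.ker φ).map π
      rw [hg, Lg, Submodule.map_comap_eq_of_surjective hπ]
    let e2 : {g : Fin N → V // LinearMap.ker φ = Lg π g} ≃
        {v : Fin N → K // Submodule.span R (Set.range v) = ⊤} :=
      { toFun := fun g => ⟨fun i => ⟨g.1 i, by
            rw [← hgK g.1 g.2]
            exact Submodule.subset_span ⟨i, rfl⟩⟩, by
              apply Submodule.map_injective_of_injective K.injective_subtype
              rw [← hspan, Submodule.map_subtype_top]
              exact hgK g.1 g.2⟩
        invFun := fun v => ⟨fun i => v.1 i, by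
          rw [Lg, hspan, v.2, Submodule.map_subtype_top, hcom]⟩
        left_inv := fun _ => rfl
        right_inv := fun _ => rfl }
    rw [Nat.card_congr e2, card_span_local]
    have hrank : Module.finrank (ResidueField R) (TensorProduct R (ResidueField R) K) = N := by
      apply le_antisymm
      · refine le_trans ?_ (schanuel hM N φ hφ)
        let f : LinearMap.ker φ →ₗ[R] K := π.submoduleMap (LinearMap.ker φ)
        have hf : Function.Surjective f := π.submoduleMap_surjective _
        have hs : Function.Surjective (f.baseChange (ResidueField R)) :=
          LinearMap.lTensor_surjective _ hf
        exact LinearMap.finrank_le_finrank_of_surjective hs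
      · refine gens_lower ϖ hϖ hnil N k π (fun x => (hker x).1) _ ?_
        intro x
        rw [LinearMap.mem_ker, map_smul, hkM]
    rw [hrank]
    congr 2
    let ψ : V →ₗ[R] M := (LinearMap.ker π).liftQ φ (hkerφ φ) ∘ₗ
      (π.quotKerEquivOfSurjective hπ).symm.toLinearMap
    have hψ : ∀ x, ψ (π x) = φ x := by
      intro x
      have : (π.quotKerEquivOfSurjective hπ).symm (π x) = (LinearMap.ker π).mkQ x := by
        rw [LinearEquiv.symm_apply_eq]; rfl
      simp [ψ, this]
    have hψs : Function.Surjective ψ := fun m => by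
      obtain ⟨x, rfl⟩ := hφ m
      exact ⟨π x, hψ x⟩
    have hψk : LinearMap.ker ψ = K := by
      ext v
      obtain ⟨x, rfl⟩ := hπ v
      rw [LinearMap.mem_ker, hψ, ← LinearMap.mem_ker, ← hcom, Submodule.mem_comap]
    have hc := Submodule.card_eq_card_quotient_mul_card (LinearMap.ker ψ)
    rw [Nat.card_congr (ψ.quotKerEquivOfSurjective hψs).toEquiv, hψk] at hc
    have hM0 : (Nat.card M : ℝ) ≠ 0 := by
      have : 0 < Nat.card M := Nat.card_pos
      positivity
    rw [eq_div_iff hM0, hc]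
    push_cast
    ring
  have h2 : (Nat.card T2 : ℝ) = Nat.card S *
      ((Nat.card V / Nat.card M : ℝ) ^ N * wt (Nat.card (ResidueField R)) N N) := by
    rw [Nat.card_sigma]
    push_cast
    rw [Finset.sum_congr rfl (fun φ _ => hfib φ)]
    simp
  have h3 : (Nat.card Gd : ℝ) * numAut R M = Nat.card T2 := by
    rw [← Nat.card_congr e, h1]; push_cast; rfl
  change (Nat.card Gd : ℝ) * numAut R M = _
  rw [h3, h2]
  change (Nat.card {φ : (Fin N → R) →ₗ[R] M // Function.Surjective φ} : ℝ) * _ = _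
  rw [card_surj]
  have hM0 : (Nat.card M : ℝ) ≠ 0 := by
    have : 0 < Nat.card M := Nat.card_pos
    positivity
  rw [div_pow]
  field_simp

lemma padic_div {p : ℕ} [Fact p.Prime] (x : ℤ_[p]) (n : ℕ) (h : ¬ (p : ℤ_[p]) ^ (n + 1) ∣ x) :
    x ∣ (p : ℤ_[p]) ^ n := by
  have hx : x ≠ 0 := by rintro rfl; simp at h
  have hs := PadicInt.unitCoeff_spec hx
  rw [hs, Units.mul_left_dvd]
  apply pow_dvd_pow
  by_contra hlt
  apply h
  rw [hs]
  exact (pow_dvd_pow _ (by omega)).mul_left _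

lemma poly_roots {p : ℕ} [Fact p.Prime] (e D : ℕ) : ∀ (f : Polynomial ℤ_[p]), f.Monic → f.natDegree = D →
    ∀ T : Finset ℕ, T ⊆ Finset.range (p ^ e) →
    (∀ t ∈ T, (p : ℤ_[p]) ^ (D * e + 1) ∣ f.eval (t : ℤ_[p])) → T.card ≤ D := by
  induction D with
  | zero =>
    intro f hf hd T _ hT
    rw [Nat.le_zero, Finset.card_eq_zero, Finset.eq_empty_iff_forall_notMem]
    intro t ht
    have := hT t ht
    rw [(Polynomial.Monic.natDegree_eq_zero hf).1 hd] at this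
    simp at this
    exact PadicInt.prime_p.not_isUnit (isUnit_of_dvd_one this)
  | succ D ih =>
    intro f hf hd T hTr hT
    rcases T.eq_empty_or_nonempty with rfl | ⟨t0, ht0⟩
    · simp
    have hroot : (Polynomial.X - Polynomial.C (t0 : ℤ_[p])) ∣ f - Polynomial.C (f.eval (t0 : ℤ_[p])) := by
      rw [Polynomial.dvd_iff_isRoot]; simp
    obtain ⟨h, hh⟩ := hroot
    have hmon : (f - Polynomial.C (f.eval (t0 : ℤ_[p]))).Monic := by
      apply hf.sub_of_left
      exact lt_of_le_of_lt Polynomial.degree_C_le (by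
        rw [Polynomial.degree_eq_natDegree hf.ne_zero, hd]; exact_mod_cast Nat.succ_pos D)
    have hhm : h.Monic := by
      rw [hh] at hmon
      exact (Polynomial.monic_X_sub_C _).of_mul_monic_left hmon
    have hhd : h.natDegree = D := by
      have h1 : (f - Polynomial.C (f.eval (t0 : ℤ_[p]))).natDegree = D + 1 := by
        rw [Polynomial.natDegree_sub_C, hd]
      rw [hh, (Polynomial.monic_X_sub_C _).natDegree_mul hhm, Polynomial.natDegree_X_sub_C] at h1
      omega
    have := ih h hhm hhd (T.erase t0) ((Finset.erase_subset _ _).trans hTr) (by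
      intro t ht
      rw [Finset.mem_erase] at ht
      have hdv : (p : ℤ_[p]) ^ ((D + 1) * e + 1) ∣ ((t : ℤ_[p]) - t0) * h.eval (t : ℤ_[p]) := by
        have h2 := congrArg (Polynomial.eval (t : ℤ_[p])) hh
        simp at h2
        rw [← h2]
        exact dvd_sub (hT t ht.2) (hT t0 ht0)
      have hnd : ¬ (p : ℤ_[p]) ^ e ∣ ((t : ℤ_[p]) - t0) := by
        intro hc
        have hc' : (p : ℤ_[p]) ^ e ∣ (((t : ℤ) - t0 : ℤ) : ℤ_[p]) := by push_cast; exact hc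
        rw [PadicInt.pow_p_dvd_int_iff] at hc'
        have h3 := Finset.mem_range.1 (hTr ht.2)
        have h4 := Finset.mem_range.1 (hTr ht0)
        have h5 := Int.eq_zero_of_abs_lt_dvd hc' (by
          rw [abs_lt]
          have h7 : (t : ℤ) < (p : ℤ) ^ e := by exact_mod_cast h3
          have h8 : (t0 : ℤ) < (p : ℤ) ^ e := by exact_mod_cast h4
          constructor <;> linarith [Int.natCast_nonneg t, Int.natCast_nonneg t0])
        apply ht.1; omega
      have hx : (t : ℤ_[p]) - t0 ≠ 0 := by intro h0; rw [h0] at hnd; simp at hnd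
      rcases e with _ | e
      · simp at hnd
      obtain ⟨c, hc⟩ := padic_div _ e hnd
      have h6 : (p : ℤ_[p]) ^ e * (p : ℤ_[p]) ^ (D * (e+1) + 1) ∣ (p : ℤ_[p]) ^ e * h.eval (t : ℤ_[p]) := by
        rw [← pow_add, hc, mul_right_comm]
        apply Dvd.dvd.mul_right
        refine (pow_dvd_pow _ ?_).trans hdv
        ring_nf; omega
      exact (mul_dvd_mul_iff_left (pow_ne_zero _ PadicInt.prime_p.ne_zero)).1 h6)
    rw [Finset.card_erase_of_mem ht0] at this
    omega

lemma bad_one {p : ℕ} [Fact p.Prime] {R : Type} [CommRing R] [Algebra ℤ_[p] R] [Module.Finite ℤ_[p] R]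
    (N e D : ℕ) (hD : D = (⊤ : Submodule ℤ_[p] (Fin N → R)).spanFinrank)
    {V : Type} [AddCommGroup V] [Module R V]
    (π : (Fin N → R) →ₗ[R] V) (hπ : Function.Surjective π) (g : Fin N → V) (T : Finset ℕ)
    (hT : T ⊆ Finset.range (p ^ e))
    (hbad : ∀ t ∈ T, ¬ ∀ x, (p : R) ^ (D * e) • x ∈ Lg π (g - fun j => (t : R) • π (Pi.single j 1))) :
    T.card ≤ D := by
  choose y hy using fun j => hπ (g j)
  let A : Module.End R (Fin N → R) := (Pi.basisFun R (Fin N)).constr R y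
  have hA : ∀ j, A (Pi.single j 1) = y j := by
    intro j
    have := (Pi.basisFun R (Fin N)).constr_basis R y j
    rwa [Pi.basisFun_apply] at this
  obtain ⟨f, hf, hd, hz⟩ := LinearMap.exists_monic_and_natDegree_eq_and_aeval_eq_zero (R := ℤ_[p]) (M := Fin N → R)
    (f := A.restrictScalars ℤ_[p])
  refine poly_roots e D f hf (hd.trans hD.symm) T hT ?_
  intro t ht
  by_contra hnd
  apply hbad t ht
  obtain ⟨c, hc⟩ := padic_div _ _ hnd
  obtain ⟨h, hh⟩ : (Polynomial.X - Polynomial.C (t : ℤ_[p])) ∣ f - Polynomial.C (f.eval (t : ℤ_[p])) := by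
      rw [Polynomial.dvd_iff_isRoot]; simp
  have hh2 := congrArg (Polynomial.aeval (A.restrictScalars ℤ_[p])) hh
  rw [map_sub, hz, map_mul, map_sub, Polynomial.aeval_X, Polynomial.aeval_C, Polynomial.aeval_C, zero_sub] at hh2
  have hrange : ∀ w : Fin N → R, A w - (t : R) • w ∈ Lg π (g - fun j => (t : R) • π (Pi.single j 1)) := by
    intro w
    rw [pi_eq_sum_univ' w]
    simp only [map_sum, Finset.smul_sum, ← Finset.sum_sub_distrib]
    apply Submodule.sum_mem
    intro j _
    rw [map_smul, smul_comm, ← smul_sub]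
    apply Submodule.smul_mem
    rw [Lg, Submodule.mem_comap, map_sub, hA, hy, map_smul]
    exact Submodule.subset_span ⟨j, rfl⟩
  intro x
  have hx := LinearMap.congr_fun hh2 x
  have hx2 : (f.eval (t : ℤ_[p])) • x = -(A (Polynomial.aeval (A.restrictScalars ℤ_[p]) h x)
      - (t : R) • (Polynomial.aeval (A.restrictScalars ℤ_[p]) h x)) := by
    have e1 : ∀ z : Fin N → R, (t : ℤ_[p]) • z = (t : R) • z := by
      intro z; rw [Nat.cast_smul_eq_nsmul, Nat.cast_smul_eq_nsmul]
    simp only [LinearMap.neg_apply, Module.End.mul_apply, LinearMap.sub_apply,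
      Module.algebraMap_end_apply, LinearMap.restrictScalars_apply, e1] at hx
    rw [← hx, neg_neg]
  have : (p : R) ^ (D * e) • x = algebraMap ℤ_[p] R c • (f.eval (t : ℤ_[p]) • x) := by
    rw [algebraMap_smul, smul_smul, mul_comm c, ← hc]
    ext i
    simp [Algebra.smul_def]
  rw [this, hx2]
  exact Submodule.smul_mem _ _ (Submodule.neg_mem _ (hrange _))

lemma bad_count {p : ℕ} [Fact p.Prime] {R : Type} [CommRing R] [Algebra ℤ_[p] R] [Module.Finite ℤ_[p] R]
    (N e D : ℕ) (hD : D = (⊤ : Submodule ℤ_[p] (Fin N → R)).spanFinrank)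
    {V : Type} [AddCommGroup V] [Module R V] [Finite V]
    (π : (Fin N → R) →ₗ[R] V) (hπ : Function.Surjective π) :
    p ^ e * Nat.card {g : Fin N → V // ¬ ∀ x, (p : R) ^ (D * e) • x ∈ Lg π g} ≤
      Nat.card V ^ N * D := by
  classical
  have := Fintype.ofFinite V
  let s : ℕ → Fin N → V := fun t j => (t : R) • π (Pi.single j 1)
  let Bad : (Fin N → V) → Prop := fun g => ¬ ∀ x, (p : R) ^ (D * e) • x ∈ Lg π g
  have h := Finset.sum_card_bipartiteAbove_eq_sum_card_bipartiteBelow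
    (s := Finset.range (p ^ e)) (t := (Finset.univ : Finset (Fin N → V))) (fun t g => Bad (g - s t))
  have h1 : ∀ t, ((Finset.univ : Finset (Fin N → V)).bipartiteAbove (fun t g => Bad (g - s t)) t).card =
      Nat.card {g : Fin N → V // Bad g} := by
    intro t
    rw [Finset.bipartiteAbove, ← Fintype.card_subtype, ← Nat.card_eq_fintype_card]
    exact Nat.card_congr ((Equiv.subRight (s t)).subtypeEquiv fun g => Iff.rfl)
  have h2 : ∀ g, ((Finset.range (p ^ e)).bipartiteBelow (fun t g => Bad (g - s t)) g).card ≤ D := by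
    intro g
    refine bad_one N e D hD π hπ g _ (Finset.filter_subset _ _) ?_
    intro t ht
    exact (Finset.mem_filter.1 ht).2
  rw [Finset.sum_congr rfl (fun t _ => h1 t), Finset.sum_const, Finset.card_range, smul_eq_mul] at h
  change p ^ e * Nat.card {g : Fin N → V // Bad g} ≤ _
  rw [h]
  refine (Finset.sum_le_sum fun g _ => h2 g).trans ?_
  simp

section secE
open Filter Topology

section arith
variable {p : ℕ} [Fact p.Prime] {R : Type} [CommRing R] [Algebra ℤ_[p] R]

lemma kill (p : ℕ) [Fact p.Prime] {R : Type} [CommRing R] [Algebra ℤ_[p] R]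
    (M : Type) [AddCommGroup M] [Module R M] [Finite M] :
    ∃ n, ∀ k, n ≤ k → ∀ m : M, (p : R) ^ k • m = 0 := by
  have hp : 1 < p := (Fact.out : p.Prime).one_lt
  have h : ¬ (p : ℤ_[p]) ^ (Nat.card M + 1) ∣ (Nat.card M : ℤ_[p]) := by
    intro h
    have h' : (p : ℤ_[p]) ^ (Nat.card M + 1) ∣ (((Nat.card M : ℕ) : ℤ) : ℤ_[p]) := by
      push_cast; exact h
    rw [PadicInt.pow_p_dvd_int_iff] at h'
    have h2 : p ^ (Nat.card M + 1) ∣ Nat.card M := by exact_mod_cast h'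
    have h3 := Nat.le_of_dvd Nat.card_pos h2
    have h4 := Nat.lt_pow_self hp (n := Nat.card M + 1)
    omega
  obtain ⟨c, hc⟩ := padic_div _ _ h
  refine ⟨Nat.card M, fun k hk m => ?_⟩
  obtain ⟨d, rfl⟩ := Nat.exists_eq_add_of_le hk
  have h5 : (p : R) ^ Nat.card M = Nat.card M * algebraMap ℤ_[p] R c := by
    have := congrArg (algebraMap ℤ_[p] R) hc
    simpa using this
  rw [pow_add, h5, mul_comm (Nat.card M : R), mul_right_comm, mul_smul, Nat.cast_smul_eq_nsmul,
    card_nsmul_eq_zero', smul_zero]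

lemma p_mem (p : ℕ) [Fact p.Prime] {R : Type} [CommRing R] [Algebra ℤ_[p] R] [IsLocalRing R]
    [Finite (ResidueField R)] : (p : R) ∈ maximalIdeal R := by
  obtain ⟨n, hn⟩ := kill p (R := R) (ResidueField R)
  have h := hn n le_rfl 1
  rw [Algebra.smul_def, mul_one, map_pow] at h
  exact (residue_eq_zero_iff _).1 (eq_zero_of_pow_eq_zero h)

lemma finite_quot (p : ℕ) [Fact p.Prime] {R : Type} [CommRing R] [Algebra ℤ_[p] R]
    [Module.Finite ℤ_[p] R] (k : ℕ) : Finite (R ⧸ Ideal.span {(p : R) ^ k}) := by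
  obtain ⟨n, s, hs⟩ := Module.Finite.exists_fin (R := ℤ_[p]) (M := R)
  let f : (Fin n → Fin (p ^ k)) → R ⧸ Ideal.span {(p : R) ^ k} :=
    fun c => Ideal.Quotient.mk _ (∑ i, ((c i : ℕ) : R) * s i)
  apply Finite.of_surjective f
  intro r
  obtain ⟨r, rfl⟩ := Ideal.Quotient.mk_surjective r
  have hr : r ∈ Submodule.span ℤ_[p] (Set.range s) := by rw [hs]; trivial
  rw [Submodule.mem_span_range_iff_exists_fun] at hr
  obtain ⟨a, rfl⟩ := hr
  refine ⟨fun i => ⟨PadicInt.appr (a i) k, PadicInt.appr_lt _ _⟩, ?_⟩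
  simp only [f]
  rw [eq_comm, Ideal.Quotient.eq, ← Finset.sum_sub_distrib]
  apply Ideal.sum_mem
  intro i _
  have h := PadicInt.appr_spec k (a i)
  rw [Ideal.mem_span_singleton] at h
  obtain ⟨c, hc⟩ := h
  rw [Algebra.smul_def, ← sub_mul]
  apply Ideal.mul_mem_right
  rw [Ideal.mem_span_singleton]
  refine ⟨algebraMap _ _ c, ?_⟩
  have := congrArg (algebraMap ℤ_[p] R) hc
  simpa using this

end arith

lemma good_coker {R : Type} [CommRing R] [IsLocalRing R] (ϖ : R) (hϖ : ϖ ∈ maximalIdeal R)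
    (N k : ℕ) (hN : 0 < N) {V : Type} [AddCommGroup V] [Module R V] [Finite V]
    (π : (Fin N → R) →ₗ[R] V) (hπ : Function.Surjective π)
    (hker : ∀ x, π x = 0 ↔ ∃ y, x = ϖ ^ (k + 1) • y) (g : Fin N → V)
    (hg : ∀ x, ϖ ^ k • x ∈ Lg π g) :
    Finite ((Fin N → R) ⧸ Lg π g) ∧ OccursAsCokernel R ((Fin N → R) ⧸ Lg π g) := by
  constructor
  · let f : (Fin N → R) →ₗ[R] V ⧸ (Submodule.span R (Set.range g)) := Submodule.mkQ _ ∘ₗ π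
    have hf : LinearMap.ker f = Lg π g := by
      rw [LinearMap.ker_comp, Submodule.ker_mkQ]; rfl
    rw [← hf]
    have : Finite (V ⧸ (Submodule.span R (Set.range g))) :=
      Finite.of_surjective _ (Submodule.mkQ_surjective _)
    have : Finite (LinearMap.range f) := Subtype.finite
    exact Finite.of_injective _ f.quotKerEquivRange.injective
  · choose y hy using fun j => hπ (g j)
    have hmap : (Submodule.span R (Set.range y)).map π = Submodule.span R (Set.range g) := by
      rw [Submodule.map_span, ← Set.range_comp]
      congr 2
      ext j; exact hy j
    have hle : Submodule.span R (Set.range y) ≤ Lg π g := by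
      rw [Lg, ← Submodule.map_le_iff_le_comap, hmap]
    have hL : ∀ x ∈ Lg π g, ∃ z ∈ Submodule.span R (Set.range y), ∃ w, x = z + ϖ ^ (k + 1) • w := by
      intro x hx
      rw [Lg, Submodule.mem_comap, ← hmap] at hx
      obtain ⟨z, hz, hzx⟩ := hx
      obtain ⟨w, hw⟩ := (hker (x - z)).1 (by rw [map_sub, hzx, sub_self])
      exact ⟨z, hz, w, by rw [← hw]; abel⟩
    have hW : (⊤ : Submodule R (Fin N → R)).map (LinearMap.lsmul R _ (ϖ ^ k)) ≤
        Submodule.span R (Set.range y) := by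
      apply Submodule.le_of_le_smul_of_le_jacobson_bot (I := maximalIdeal R)
      · exact Submodule.FG.map _ Module.Finite.fg_top
      · rw [IsLocalRing.jacobson_eq_maximalIdeal _ bot_ne_top]
      · rintro _ ⟨u, -, rfl⟩
        obtain ⟨z, hz, w, hw⟩ := hL _ (hg u)
        change ϖ ^ k • u ∈ _
        rw [hw]
        apply Submodule.add_mem_sup hz
        rw [pow_succ', mul_smul]
        exact Submodule.smul_mem_smul hϖ ⟨w, trivial, rfl⟩
    have hEq : Lg π g = Submodule.span R (Set.range y) := by
      apply le_antisymm _ hle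
      intro x hx
      obtain ⟨z, hz, w, rfl⟩ := hL x hx
      apply Submodule.add_mem _ hz
      rw [pow_succ', mul_smul]
      exact Submodule.smul_mem _ _ (hW ⟨w, trivial, rfl⟩)
    refine ⟨N, hN, (Pi.basisFun R (Fin N)).constr R y, ⟨Submodule.quotEquivOfEq _ _ ?_⟩⟩
    rw [Module.Basis.constr_range, hEq]

lemma wt_nonneg {q : ℕ} (hq : 1 < q) (N r : ℕ) : 0 ≤ wt q N r := by
  apply Finset.prod_nonneg
  intro i _
  have : (q : ℝ)⁻¹ ^ (N - i) ≤ 1 := pow_le_one₀ (by positivity) (inv_le_one_of_one_le₀ (by exact_mod_cast hq.le))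
  linarith

lemma wt_le_one {q : ℕ} (hq : 1 < q) (N r : ℕ) : wt q N r ≤ 1 := by
  apply Finset.prod_le_one
  · intro i _
    have : (q : ℝ)⁻¹ ^ (N - i) ≤ 1 := pow_le_one₀ (by positivity) (inv_le_one_of_one_le₀ (by exact_mod_cast hq.le))
    linarith
  · intro i _
    have : 0 ≤ (q : ℝ)⁻¹ ^ (N - i) := by positivity
    linarith

lemma wt_tendsto {q : ℕ} (hq : 1 < q) (r : ℕ) : Tendsto (fun N => wt q N r) atTop (𝓝 1) := by
  have h : Tendsto (fun N => wt q N r) atTop (𝓝 (∏ i ∈ Finset.range r, (1 - 0 : ℝ))) := by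
    unfold wt
    apply tendsto_finsetProd
    intro i _
    apply Tendsto.const_sub
    exact (tendsto_pow_atTop_nhds_zero_of_lt_one (by positivity)
      (inv_lt_one_of_one_lt₀ (by exact_mod_cast hq))).comp (tendsto_sub_atTop_nat i)
  simpa using h

lemma wt_self {q : ℕ} (N : ℕ) : wt q N N = ∏ i ∈ Finset.range N, (1 - (q:ℝ)⁻¹ ^ (i + 1)) := by
  rw [wt, ← Finset.prod_range_reflect]
  apply Finset.prod_congr rfl
  intro i hi
  rw [Finset.mem_range] at hi
  congr 2
  omega

lemma c_facts {q : ℕ} (hq : 1 < q) : 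
    Tendsto (fun N => wt q N N) atTop (𝓝 (∏' i : ℕ, (1 - (q:ℝ)⁻¹ ^ (i + 1)))) ∧
    0 < ∏' i : ℕ, (1 - (q:ℝ)⁻¹ ^ (i + 1)) := by
  have hx0 : 0 < (q:ℝ)⁻¹ := by positivity
  have hx1 : (q:ℝ)⁻¹ < 1 := inv_lt_one_of_one_lt₀ (by exact_mod_cast hq)
  have hsum : Summable (fun i : ℕ => ‖-((q:ℝ)⁻¹ ^ (i + 1))‖) := by
    simp only [norm_neg, norm_pow, Real.norm_eq_abs, abs_of_pos hx0]
    exact (summable_nat_add_iff 1).2 (summable_geometric_of_lt_one hx0.le hx1)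
  have hlt : ∀ i : ℕ, (q:ℝ)⁻¹ ^ (i + 1) < 1 := fun i => pow_lt_one₀ hx0.le hx1 (by omega)
  have hm : Multipliable (fun i : ℕ => (1 - (q:ℝ)⁻¹ ^ (i + 1))) := by
    simpa [sub_eq_add_neg] using multipliable_one_add_of_summable hsum
  have ht := hm.hasProd.tendsto_prod_nat
  constructor
  · simpa only [wt_self] using ht
  · apply lt_of_le_of_ne
    · exact ge_of_tendsto' ht fun N => Finset.prod_nonneg fun i _ => by linarith [hlt i]
    · have := tprod_one_add_ne_zero_of_summable (f := fun i : ℕ => -((q:ℝ)⁻¹ ^ (i + 1)))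
        (fun i => by have := hlt i; simp only [← sub_eq_add_neg]; linarith) hsum
      simpa only [sub_eq_add_neg] using this.symm

lemma numAut_pos {R M : Type} [CommRing R] [AddCommGroup M] [Module R M] [Finite M] :
    0 < numAut R M := by
  have : Finite (M ≃ₗ[R] M) := Finite.of_injective (fun e => (e : M → M)) DFunLike.coe_injective
  exact Nat.card_pos

end secE

theorem statement5 (p : ℕ) [Fact p.Prime] (R : Type) [CommRing R] [IsLocalRing R]
    [Algebra ℤ_[p] R] (hinj : Function.Injective (algebraMap ℤ_[p] R))
    [Module.Finite ℤ_[p] R] [Finite (ResidueField R)]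
    -- `Mod : ι → ModuleCat R` is a complete irredundant family of representatives of the
    -- isomorphism classes of finite `R`-modules occurring as cokernels:
    (ι : Type) (Mod : ι → ModuleCat.{0} R)
    (hfin : ∀ i, Finite (Mod i))
    (hcok : ∀ i, OccursAsCokernel R (Mod i))
    (hcomplete : ∀ (M : Type) [AddCommGroup M] [Module R M], Finite M →
      OccursAsCokernel R M → ∃ i, Nonempty (M ≃ₗ[R] Mod i))
    (hirr : ∀ i j, Nonempty ((Mod i : Type) ≃ₗ[R] Mod j) → i = j) :
    HasSum (fun i => ((numAut R (Mod i) : ℝ))⁻¹) (cConst R)⁻¹ := by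
  classical
  have hnoeth : IsNoetherianRing R := isNoetherian_of_isNoetherianRing_of_finite ℤ_[p] R |> fun _ =>
    isNoetherian_of_tower ℤ_[p] inferInstance
  have hϖ := p_mem p (R := R)
  have hp1 : 1 < p := (Fact.out : p.Prime).one_lt
  have hnil : ∀ j : ℕ, (p : R) ^ j ≠ 0 := by
    intro j hj
    have : algebraMap ℤ_[p] R ((p : ℤ_[p]) ^ j) = algebraMap ℤ_[p] R 0 := by simpa using hj
    exact pow_ne_zero _ PadicInt.prime_p.ne_zero (hinj this)
  set q := Nat.card (ResidueField R) with hqdef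
  have hq : 1 < q := Finite.one_lt_card
  obtain ⟨hctend, hcpos⟩ := c_facts hq
  let a : ι → ℝ := fun i => ((numAut R (Mod i) : ℝ))⁻¹
  let r : ι → ℕ := fun i => Module.finrank (ResidueField R) (TensorProduct R (ResidueField R) (Mod i))
  have ha : ∀ i, 0 ≤ a i := fun i => by positivity
  have hmodel : ∀ N k : ℕ, ∃ (V : Type) (_ : AddCommGroup V) (_ : Module R V) (_ : Finite V)
      (π : (Fin N → R) →ₗ[R] V), Function.Surjective π ∧
      ∀ x, π x = 0 ↔ ∃ y, x = (p : R) ^ (k + 1) • y := by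
    intro N k
    have := finite_quot p (R := R) (k + 1)
    refine ⟨Fin N → R ⧸ Ideal.span {(p : R) ^ (k + 1)}, inferInstance, inferInstance, inferInstance,
      (Submodule.mkQ (Ideal.span {(p : R) ^ (k + 1)})).compLeft (Fin N), ?_, ?_⟩
    · intro v
      choose x hx using fun j => Submodule.mkQ_surjective (Ideal.span {(p : R) ^ (k + 1)}) (v j)
      exact ⟨x, funext hx⟩
    · intro x
      constructor
      · intro hx
        have : ∀ j, ∃ c, x j = (p : R) ^ (k + 1) * c := by
          intro j
          have h1 := congrFun hx j
          have h2 : x j ∈ Ideal.span {(p : R) ^ (k + 1)} := by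
            rw [← Submodule.ker_mkQ (Ideal.span {(p : R) ^ (k + 1)})]
            exact h1
          exact Ideal.mem_span_singleton.1 h2
        choose y hy using this
        exact ⟨y, funext hy⟩
      · rintro ⟨y, rfl⟩
        ext j
        change (Submodule.mkQ (Ideal.span {(p : R) ^ (k + 1)})) ((p : R) ^ (k + 1) * y j) = 0
        rw [← LinearMap.mem_ker, Submodule.ker_mkQ]
        exact Ideal.mem_span_singleton.2 ⟨_, rfl⟩
  -- the count, normalised
  have hcount : ∀ (N k : ℕ) (V : Type) [AddCommGroup V] [Module R V] [Finite V]
      (π : (Fin N → R) →ₗ[R] V), Function.Surjective π →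
      (∀ x, π x = 0 ↔ ∃ y, x = (p : R) ^ (k + 1) • y) → ∀ i, (∀ m : Mod i, (p : R) ^ k • m = 0) →
      (Nat.card {g : Fin N → V // Nonempty (((Fin N → R) ⧸ Lg π g) ≃ₗ[R] Mod i)} : ℝ) =
        (Nat.card V : ℝ) ^ N * (a i * (wt q N (r i) * wt q N N)) := by
    intro N k V _ _ _ π hπ hker i hki
    have := hfin i
    have h := count (p : R) hϖ hnil N k π hπ hker (hcok i) hki
    have hA : (numAut R (Mod i) : ℝ) ≠ 0 := by
      have := numAut_pos (R := R) (M := Mod i)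
      positivity
    rw [← eq_mul_inv_iff_mul_eq₀ hA] at h
    rw [h]
    simp only [a, r, ← hqdef]
    ring
  have hupper : ∀ (S : Finset ι) (N : ℕ), ∑ i ∈ S, a i * (wt q N (r i) * wt q N N) ≤ 1 := by
    intro S N
    have hk : ∀ i, ∃ n, ∀ k, n ≤ k → ∀ m : Mod i, (p : R) ^ k • m = 0 := by
      intro i
      have := hfin i
      exact kill p (R := R) (Mod i)
    choose n hn using hk
    let k := S.sup n
    obtain ⟨V, _, _, _, π, hπ, hker⟩ := hmodel N k
    have := Fintype.ofFinite V
    have hV : 0 < (Nat.card V : ℝ) ^ N := by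
      have : 0 < Nat.card V := Nat.card_pos
      positivity
    have h1 : (Nat.card V : ℝ) ^ N * ∑ i ∈ S, a i * (wt q N (r i) * wt q N N) ≤ (Nat.card V : ℝ) ^ N := by
      rw [Finset.mul_sum, ← Finset.sum_congr rfl (fun i hi => hcount N k V π hπ hker i
        (hn i k (Finset.le_sup hi)))]
      have h2 : ∑ i ∈ S, Nat.card {g : Fin N → V // Nonempty (((Fin N → R) ⧸ Lg π g) ≃ₗ[R] Mod i)}
          ≤ Nat.card V ^ N := by
        simp only [Nat.card_eq_fintype_card, Fintype.card_subtype]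
        rw [← Finset.card_biUnion]
        · refine (Finset.card_le_univ _).trans ?_
          simp
        · intro i _ j _ hij
          rw [Function.onFun, Finset.disjoint_left]
          intro g hgi hgj
          obtain ⟨ei⟩ := (Finset.mem_filter.1 hgi).2
          obtain ⟨ej⟩ := (Finset.mem_filter.1 hgj).2
          exact hij (hirr i j ⟨ei.symm.trans ej⟩)
      exact_mod_cast h2
    exact le_of_mul_le_mul_left (by linarith) hV
  have hlower : ∀ (N e : ℕ), 0 < N → ∃ S : Finset ι,
      1 - ((⊤ : Submodule ℤ_[p] (Fin N → R)).spanFinrank : ℝ) * ((p : ℝ)⁻¹) ^ e ≤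
      ∑ i ∈ S, a i * (wt q N (r i) * wt q N N) := by
    intro N e hN
    set D := (⊤ : Submodule ℤ_[p] (Fin N → R)).spanFinrank with hD
    obtain ⟨V, _, _, _, π, hπ, hker⟩ := hmodel N (D * e)
    have := Fintype.ofFinite V
    have hV : 0 < (Nat.card V : ℝ) ^ N := by
      have : 0 < Nat.card V := Nat.card_pos
      positivity
    have hbad := bad_count N e D hD π hπ
    let Good : (Fin N → V) → Prop := fun g => ∀ x, (p : R) ^ (D * e) • x ∈ Lg π g
    have hcl : ∀ g : {g // Good g}, ∃ i, Nonempty (((Fin N → R) ⧸ Lg π g.1) ≃ₗ[R] Mod i) := by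
      intro g
      obtain ⟨h1, h2⟩ := good_coker (p : R) hϖ N (D * e) hN π hπ hker g.1 g.2
      exact hcomplete _ h1 h2
    choose cl hcl using hcl
    let S : Finset ι := Finset.univ.image cl
    refine ⟨S, ?_⟩
    have hkS : ∀ i ∈ S, ∀ m : Mod i, (p : R) ^ (D * e) • m = 0 := by
      intro i hi m
      obtain ⟨g, -, rfl⟩ := Finset.mem_image.1 hi
      obtain ⟨E⟩ := hcl g
      obtain ⟨x, rfl⟩ := (E.surjective.comp (Submodule.mkQ_surjective _)) m
      rw [Function.comp_apply, ← map_smul, ← map_smul]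
      rw [show (Lg π g.1).mkQ ((p : R) ^ (D * e) • x) = 0 by
        rw [← LinearMap.mem_ker, Submodule.ker_mkQ]; exact g.2 x, map_zero]
    have h2 : Nat.card V ^ N ≤ Nat.card {g // ¬ Good g} +
        ∑ i ∈ S, Nat.card {g : Fin N → V // Nonempty (((Fin N → R) ⧸ Lg π g) ≃ₗ[R] Mod i)} := by
      simp only [Nat.card_eq_fintype_card, Fintype.card_subtype]
      have h3 : (Finset.univ : Finset (Fin N → V)) ⊆ (Finset.univ.filter fun g => ¬ Good g) ∪
          S.biUnion (fun i => Finset.univ.filter fun g => Nonempty (((Fin N → R) ⧸ Lg π g) ≃ₗ[R] Mod i)) := by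
        intro g _
        rw [Finset.mem_union]
        by_cases hg : Good g
        · right
          rw [Finset.mem_biUnion]
          exact ⟨cl ⟨g, hg⟩, Finset.mem_image_of_mem _ (Finset.mem_univ _),
            Finset.mem_filter.2 ⟨Finset.mem_univ _, hcl ⟨g, hg⟩⟩⟩
        · left
          exact Finset.mem_filter.2 ⟨Finset.mem_univ _, hg⟩
      have h4 := (Finset.card_le_card h3).trans (Finset.card_union_le _ _)
      have h5 := Finset.card_biUnion_le (s := S) (t := fun i => Finset.univ.filter
        fun g : Fin N → V => Nonempty (((Fin N → R) ⧸ Lg π g) ≃ₗ[R] Mod i))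
      have h6 : (Finset.univ : Finset (Fin N → V)).card = Fintype.card V ^ N := by simp
      omega
    have h7 : (Nat.card V : ℝ) ^ N ≤ Nat.card {g // ¬ Good g} +
        (Nat.card V : ℝ) ^ N * ∑ i ∈ S, a i * (wt q N (r i) * wt q N N) := by
      rw [Finset.mul_sum, ← Finset.sum_congr rfl (fun i hi => hcount N (D * e) V π hπ hker i
        (hkS i hi))]
      exact_mod_cast h2
    have h8 : (Nat.card {g // ¬ Good g} : ℝ) ≤ (Nat.card V : ℝ) ^ N * (D * ((p : ℝ)⁻¹) ^ e) := by
      have h9 : (p : ℝ) ^ e * Nat.card {g // ¬ Good g} ≤ (Nat.card V : ℝ) ^ N * D := by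
        have hbad' : p ^ e * Nat.card {g // ¬ Good g} ≤ Nat.card V ^ N * D := hbad
        generalize Nat.card {g // ¬ Good g} = B at hbad' ⊢
        exact_mod_cast hbad'
      have hpe : (0 : ℝ) < (p : ℝ) ^ e := by positivity
      rw [inv_pow, ← mul_assoc, ← div_eq_mul_inv, le_div_iff₀ hpe]
      linarith
    refine le_of_mul_le_mul_left ?_ hV
    linarith
  apply hasSum_of_isLUB_of_nonneg _ ha
  change IsLUB _ (∏' i : ℕ, (1 - (q:ℝ)⁻¹ ^ (i + 1)))⁻¹
  set c := ∏' i : ℕ, (1 - (q:ℝ)⁻¹ ^ (i + 1))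
  constructor
  · rintro _ ⟨S, rfl⟩
    have ht : Filter.Tendsto (fun N => ∑ i ∈ S, a i * (wt q N (r i) * wt q N N)) Filter.atTop
        (nhds (∑ i ∈ S, a i * (1 * c))) :=
      tendsto_finsetSum _ fun i _ => ((wt_tendsto hq (r i)).mul hctend).const_mul (a i)
    have h1 := le_of_tendsto' ht (hupper S)
    rw [one_mul, ← Finset.sum_mul] at h1
    change ∑ i ∈ S, a i ≤ c⁻¹
    rwa [← one_div, le_div_iff₀ hcpos]
  · intro b hb
    have hb' : ∀ S : Finset ι, ∑ i ∈ S, a i ≤ b := fun S => hb ⟨S, rfl⟩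
    have h1 : ∀ N, 0 < N → 1 ≤ b * wt q N N := by
      intro N hN
      have ht : Filter.Tendsto (fun e : ℕ => 1 - ((⊤ : Submodule ℤ_[p] (Fin N → R)).spanFinrank : ℝ) *
          ((p : ℝ)⁻¹) ^ e) Filter.atTop (nhds (1 - ((⊤ : Submodule ℤ_[p] (Fin N → R)).spanFinrank : ℝ) * 0)) :=
        ((tendsto_pow_atTop_nhds_zero_of_lt_one (by positivity)
          (inv_lt_one_of_one_lt₀ (by exact_mod_cast hp1))).const_mul _).const_sub _
      rw [mul_zero, sub_zero] at ht
      refine le_of_tendsto' ht fun e => ?_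
      obtain ⟨S, hS⟩ := hlower N e hN
      refine hS.trans (le_trans ?_ (mul_le_mul_of_nonneg_right (hb' S) (wt_nonneg hq N N)))
      rw [Finset.sum_mul]
      apply Finset.sum_le_sum
      intro i _
      apply mul_le_mul_of_nonneg_left _ (ha i)
      exact mul_le_of_le_one_left (wt_nonneg hq N N) (wt_le_one hq N _)
    have h2 : 1 ≤ b * c := ge_of_tendsto (hctend.const_mul b)
      (Filter.eventually_atTop.2 ⟨1, fun N hN => h1 N hN⟩)
    rw [← one_div, div_le_iff₀ hcpos]
    exact h2
end

section
/- For every N ≥ 1 and every finite R-module M, one has μ_{R,N}(M) ≤ 1/#Aut_R(M). -/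
/- STATEMENT 6: For every N ≥ 1 and every finite R-module M, μ_{R,N}(M) ≤ 1/#Aut_R(M).

   Here μ_{R,N}(M) = Haar_N({G ∈ End_R(R^N) : coker G ≅ M}); as in the companion
   statements, since End_R(R^N) is the inverse limit of the finite groups
   End_{R/p^k}((R/p^k)^N) and the set {G : coker G ≅ M} is the preimage of the
   corresponding set at every sufficiently large finite level, this Haar measure is the
   limit as k → ∞ of finite-level proportions (an eventually constant sequence), which
   we take as the definition `muRN`. -/

open IsLocalRing Filter

theorem card_pre {E F : Type} [AddCommGroup E] [AddCommGroup F] [Finite E]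
    (ρ : E →+ F) (hρ : Function.Surjective ρ) (P : E → Prop) (Q : F → Prop)
    (h : ∀ e, P e ↔ Q (ρ e)) :
    (Nat.card {e // P e} : ℝ) / (Nat.card E : ℝ) = (Nat.card {f // Q f} : ℝ) / (Nat.card F : ℝ) := by
  let s := Function.surjInv hρ
  have hs : ∀ f, ρ (s f) = f := Function.surjInv_eq hρ
  let e : E ≃ F × ρ.ker :=
    { toFun := fun x => (ρ x, ⟨x - s (ρ x), by simp [AddMonoidHom.mem_ker, hs]⟩)
      invFun := fun y => s y.1 + y.2
      left_inv := fun x => by simp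
      right_inv := fun y => by
        obtain ⟨a, b, hb⟩ := y
        have hb' : ρ b = 0 := hb
        ext <;> simp [hs, hb'] }
  have h1 : Nat.card E = Nat.card F * Nat.card ρ.ker := by
    rw [Nat.card_congr e, Nat.card_prod]
  have h2 : Nat.card {e // P e} = Nat.card {f // Q f} * Nat.card ρ.ker := by
    rw [← Nat.card_prod]
    refine Nat.card_congr ((e.subtypeEquiv (q := fun y => Q y.1) (fun x => h x)).trans
      (Equiv.prodSubtypeFstEquivSubtypeProd (p := Q)))
  have h3 : (Nat.card ρ.ker : ℝ) ≠ 0 := by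
    have := Nat.card_pos (α := ρ.ker)
    positivity
  rw [h1, h2]
  push_cast
  rw [mul_div_mul_right _ _ h3]

theorem level_bound {R : Type} [CommRing R] (I : Ideal R) [Finite (R ⧸ I)] (N : ℕ)
    (M : Type) [AddCommGroup M] [Module R M] [Finite M] :
    (Nat.card {G : Module.End (R ⧸ I) (Fin N → R ⧸ I) //
      Nonempty (((Fin N → R ⧸ I) ⧸ LinearMap.range G) ≃ₗ[R] M)} : ℝ) /
    (Nat.card (Module.End (R ⧸ I) (Fin N → R ⧸ I)) : ℝ) ≤ ((numAut R M : ℝ))⁻¹ := by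
  classical
  have hfinE : Finite (Module.End (R ⧸ I) (Fin N → R ⧸ I)) :=
    Finite.of_equiv _ (LinearMap.toMatrix' (R := R ⧸ I) (m := Fin N) (n := Fin N)).toEquiv.symm
  have hfinA : Finite (M ≃ₗ[R] M) :=
    Finite.of_injective (fun f => (f : M → M)) DFunLike.coe_injective
  let S := {G : Module.End (R ⧸ I) (Fin N → R ⧸ I) //
      Nonempty (((Fin N → R ⧸ I) ⧸ LinearMap.range G) ≃ₗ[R] M)}
  let q : ∀ G : S, (Fin N → R ⧸ I) →ₗ[R] M := fun G =>
    (G.2.some : ((Fin N → R ⧸ I) ⧸ LinearMap.range G.1) →ₗ[R] M) ∘ₗ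
      ((LinearMap.range G.1).mkQ.restrictScalars R)
  have hq : ∀ G, Function.Surjective (q G) := by
    intro G m
    obtain ⟨x, hx⟩ := Submodule.mkQ_surjective (LinearMap.range G.1) (G.2.some.symm m)
    refine ⟨x, ?_⟩
    change G.2.some ((LinearMap.range G.1).mkQ x) = m
    rw [hx, LinearEquiv.apply_symm_apply]
  have hqG : ∀ G x, q G (G.1 x) = 0 := by
    intro G x
    have : (LinearMap.range G.1).mkQ (G.1 x) = 0 := by simp
    simp only [q, LinearMap.comp_apply, LinearMap.restrictScalars_apply, this, map_zero]
  have hext : ∀ f g : (Fin N → R ⧸ I) →ₗ[R] M,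
      (∀ i, f (Pi.single i 1) = g (Pi.single i 1)) → f = g := by
    intro f g h
    refine LinearMap.pi_ext fun i x => ?_
    obtain ⟨r, rfl⟩ := Ideal.Quotient.mk_surjective x
    have : (Pi.single i (Ideal.Quotient.mk I r) : Fin N → R ⧸ I) = r • Pi.single i 1 := by
      rw [← Pi.single_smul]
      congr 1
      rw [Algebra.smul_def, mul_one]; rfl
    rw [this, map_smul, map_smul, h]
  let F : ∀ (G : S) (σ : M ≃ₗ[R] M), (Fin N → R ⧸ I) →ₗ[R] M := fun G σ =>
    (σ : M →ₗ[R] M) ∘ₗ q G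
  have hF : ∀ G σ, Function.Surjective (F G σ) := fun G σ => σ.surjective.comp (hq G)
  have hFG : ∀ G σ x, F G σ (G.1 x) = 0 := by
    intro G σ x
    simp [F, hqG]
  let sec : ((Fin N → R ⧸ I) →ₗ[R] M) → M → (Fin N → R ⧸ I) := fun f =>
    Function.invFun f
  have hsec : ∀ G σ m, F G σ (sec (F G σ) m) = m := fun G σ m =>
    Function.rightInverse_invFun (hF G σ) m
  let Φ : (S × (M ≃ₗ[R] M)) × (Fin N → M) → (Fin N → M) × (Fin N → Fin N → R ⧸ I) := fun t =>
    (fun i => F t.1.1 t.1.2 (Pi.single i 1),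
     fun i => t.1.1.1 (Pi.single i 1) + sec (F t.1.1 t.1.2) (t.2 i))
  have hΦ : Function.Injective Φ := by
    rintro ⟨⟨G, σ⟩, m⟩ ⟨⟨G', σ'⟩, m'⟩ h
    have h1 : ∀ i, F G σ (Pi.single i 1) = F G' σ' (Pi.single i 1) :=
      fun i => congrFun (congrArg Prod.fst h) i
    have h2 : ∀ i, G.1 (Pi.single i 1) + sec (F G σ) (m i) =
        G'.1 (Pi.single i 1) + sec (F G' σ') (m' i) :=
      fun i => congrFun (congrArg Prod.snd h) i
    have h3 : F G σ = F G' σ' := hext _ _ h1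
    have hm : m = m' := by
      funext i
      have := congrArg (F G σ) (h2 i)
      rw [map_add, map_add, hFG, hsec, h3, hFG, hsec, zero_add, zero_add] at this
      exact this
    subst hm
    have hG : G = G' := by
      apply Subtype.ext
      refine (Pi.basisFun (R ⧸ I) (Fin N)).ext fun i => ?_
      have := h2 i
      rw [h3] at this
      simpa using this
    subst hG
    have hσ : σ = σ' := by
      ext x
      obtain ⟨y, rfl⟩ := hq G x
      exact congrArg (fun f => f y) h3
    rw [hσ]
  have hc := Nat.card_le_card_of_injective Φ hΦ
  have hEc : Nat.card (Module.End (R ⧸ I) (Fin N → R ⧸ I)) = Nat.card (Fin N → Fin N → R ⧸ I) :=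
    Nat.card_congr (LinearMap.toMatrix' (R := R ⧸ I) (m := Fin N) (n := Fin N)).toEquiv
  rw [Nat.card_prod, Nat.card_prod, Nat.card_prod, ← hEc, mul_comm] at hc
  have hc' := Nat.le_of_mul_le_mul_left hc Nat.card_pos
  have p1 : (0:ℝ) < Nat.card (Module.End (R ⧸ I) (Fin N → R ⧸ I)) := by
    exact_mod_cast Nat.card_pos
  have p2 : (0:ℝ) < Nat.card (M ≃ₗ[R] M) := by
    exact_mod_cast Nat.card_pos
  unfold numAut
  rw [div_le_iff₀ p1, ← div_eq_inv_mul, le_div_iff₀ p2]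
  exact_mod_cast hc'

theorem iso_iff {R : Type} [CommRing R] (a : R) (n : ℕ) {C D M : Type} [AddCommGroup C] [Module R C]
    [AddCommGroup D] [Module R D] [AddCommGroup M] [Module R M] (q : C →ₗ[R] D)
    (hq : Function.Surjective q) (hk : ∀ c, q c = 0 → ∃ c', c = a ^ (n + 1) • c')
    (hC : ∀ c : C, a ^ (n + 2) • c = 0) (hM : ∀ m : M, a ^ n • m = 0) :
    Nonempty (C ≃ₗ[R] M) ↔ Nonempty (D ≃ₗ[R] M) := by
  have key : (∀ c : C, a ^ n • c = 0) → Nonempty (C ≃ₗ[R] D) := by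
    intro h
    refine ⟨LinearEquiv.ofBijective q ⟨?_, hq⟩⟩
    rw [injective_iff_map_eq_zero]
    intro c hc
    obtain ⟨c', rfl⟩ := hk c hc
    rw [pow_succ', mul_smul, h, smul_zero]
  constructor
  · rintro ⟨e⟩
    obtain ⟨f⟩ := key (fun c => e.injective (by rw [map_smul, hM, map_zero]))
    exact ⟨f.symm.trans e⟩
  · rintro ⟨e⟩
    have hD : ∀ d : D, a ^ n • d = 0 := fun d => e.injective (by rw [map_smul, hM, map_zero])
    have h1 : ∀ c : C, ∃ c', a ^ n • c = a ^ (n + 1) • c' := fun c =>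
      hk _ (by rw [map_smul, hD])
    obtain ⟨f⟩ := key (fun c => by
      obtain ⟨c', h'⟩ := h1 c
      obtain ⟨c'', h''⟩ := h1 c'
      rw [h', pow_succ', mul_smul, h'', ← mul_smul, ← pow_succ', hC])
    exact ⟨f.trans e⟩

theorem level_succ (p : ℕ) {R : Type} [CommRing R] (N n : ℕ)
    (hfin : ∀ k, Finite (R ⧸ Ideal.span {(p : R) ^ k}))
    (M : Type) [AddCommGroup M] [Module R M] (hM : ∀ m : M, (p : R) ^ n • m = 0) :
    levelProportion p R N (n + 2) M = levelProportion p R N (n + 1) M := by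
  classical
  unfold levelProportion
  set I := Ideal.span {(p : R) ^ (n + 2)} with hI
  set J := Ideal.span {(p : R) ^ (n + 1)} with hJ
  have hIJ : I ≤ J := by
    rw [hI, hJ, Ideal.span_singleton_le_span_singleton]
    exact pow_dvd_pow _ (by omega)
  have hfI : Finite (R ⧸ I) := hfin _
  have hfinE : Finite (Module.End (R ⧸ I) (Fin N → R ⧸ I)) :=
    Finite.of_equiv _ (LinearMap.toMatrix' (R := R ⧸ I) (m := Fin N) (n := Fin N)).toEquiv.symm
  let π : R ⧸ I →+* R ⧸ J := Ideal.Quotient.factor hIJ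
  have hπ : Function.Surjective π := Ideal.Quotient.factor_surjective hIJ
  have hπs : ∀ (r : R) (x : R ⧸ I), π (r • x) = r • π x := by
    intro r x
    obtain ⟨x, rfl⟩ := Ideal.Quotient.mk_surjective x
    rfl
  have hπk : ∀ x, π x = 0 → ∃ y, x = (p : R) ^ (n + 1) • y := by
    intro x hx
    obtain ⟨x, rfl⟩ := Ideal.Quotient.mk_surjective x
    have hx' : Ideal.Quotient.mk J x = 0 := hx
    rw [Ideal.Quotient.eq_zero_iff_mem, hJ, Ideal.mem_span_singleton] at hx'
    obtain ⟨y, rfl⟩ := hx'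
    exact ⟨Ideal.Quotient.mk I y, rfl⟩
  let Pm : (Fin N → R ⧸ I) →ₗ[R] (Fin N → R ⧸ J) :=
    { toFun := fun x i => π (x i)
      map_add' := fun x y => by ext i; simp
      map_smul' := fun r x => by ext i; simp [hπs] }
  have hPm : Function.Surjective Pm := fun y => by
    choose g hg using hπ
    exact ⟨fun i => g (y i), by ext i; exact hg _⟩
  let ρ : Module.End (R ⧸ I) (Fin N → R ⧸ I) →+ Module.End (R ⧸ J) (Fin N → R ⧸ J) :=
    ((Matrix.toLin' (R := R ⧸ J) (m := Fin N) (n := Fin N)).toAddEquiv.toAddMonoidHom.comp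
      (AddMonoidHom.mapMatrix π.toAddMonoidHom)).comp
      (LinearMap.toMatrix' (R := R ⧸ I) (m := Fin N) (n := Fin N)).toAddEquiv.toAddMonoidHom
  have hρd : ∀ G, ρ G = Matrix.toLin' ((LinearMap.toMatrix' G).map π) := fun G => rfl
  have hρ : Function.Surjective ρ := by
    intro H
    choose g hg using hπ
    refine ⟨Matrix.toLin' ((LinearMap.toMatrix' H).map g), ?_⟩
    rw [hρd, LinearMap.toMatrix'_toLin']
    have : ((LinearMap.toMatrix' H).map g).map π = LinearMap.toMatrix' H := by
      ext i j
      exact hg _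
    rw [this, Matrix.toLin'_toMatrix']
  have hcomm : ∀ G x, Pm (G x) = ρ G (Pm x) := by
    intro G x
    have h1 : G x = (LinearMap.toMatrix' G).mulVec x := by
      rw [← Matrix.toLin'_apply, Matrix.toLin'_toMatrix']
    have h2 : ρ G (Pm x) = ((LinearMap.toMatrix' G).map π).mulVec (Pm x) := by
      rw [← Matrix.toLin'_apply, hρd]
    rw [h1, h2]
    ext i
    exact RingHom.map_mulVec π _ _ i
  refine card_pre ρ hρ _ _ fun G => ?_
  let q₀ : (Fin N → R ⧸ I) →ₗ[R] ((Fin N → R ⧸ J) ⧸ LinearMap.range (ρ G)) :=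
    ((LinearMap.range (ρ G)).mkQ.restrictScalars R) ∘ₗ Pm
  let q : ((Fin N → R ⧸ I) ⧸ LinearMap.range G) →ₗ[R] ((Fin N → R ⧸ J) ⧸ LinearMap.range (ρ G)) :=
    (((LinearMap.range G).restrictScalars R).liftQ q₀ (by
      rintro _ ⟨x, rfl⟩
      rw [LinearMap.mem_ker]
      change (LinearMap.range (ρ G)).mkQ (Pm (G x)) = 0
      rw [hcomm]
      simp)) ∘ₗ (Submodule.Quotient.restrictScalarsEquiv R (LinearMap.range G)).symm.toLinearMap
  have hqmk : ∀ x, q ((LinearMap.range G).mkQ x) = (LinearMap.range (ρ G)).mkQ (Pm x) := fun x => rfl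
  refine iso_iff (p : R) n q ?_ ?_ ?_ hM
  · intro y
    obtain ⟨y, rfl⟩ := Submodule.mkQ_surjective _ y
    obtain ⟨x, rfl⟩ := hPm y
    exact ⟨_, hqmk x⟩
  · intro c hc
    obtain ⟨x, rfl⟩ := Submodule.mkQ_surjective _ c
    rw [hqmk, ← LinearMap.mem_ker, Submodule.ker_mkQ] at hc
    obtain ⟨z, hz⟩ := hc
    obtain ⟨w, rfl⟩ := hPm z
    rw [← hcomm] at hz
    have h0 : Pm (x - G w) = 0 := by rw [map_sub, hz, sub_self]
    choose y hy using fun i => hπk ((x - G w) i) (congrFun h0 i)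
    refine ⟨(LinearMap.range G).mkQ y, ?_⟩
    have hxy : x = (p : R) ^ (n + 1) • y + G w := by
      have : x - G w = (p : R) ^ (n + 1) • y := funext hy
      rw [← this]; abel
    have hz0 : (LinearMap.range G).mkQ (G w) = 0 := by simp
    conv_lhs => rw [hxy, map_add, hz0, add_zero]
    rfl
  · intro c
    obtain ⟨x, rfl⟩ := Submodule.mkQ_surjective _ c
    have : (p : R) ^ (n + 2) • x = 0 := by
      ext i
      obtain ⟨r, hr⟩ := Ideal.Quotient.mk_surjective (x i)
      rw [Pi.smul_apply, ← hr]
      change Ideal.Quotient.mk I ((p : R) ^ (n + 2) * r) = 0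
      rw [Ideal.Quotient.eq_zero_iff_mem, hI]
      exact Ideal.mul_mem_right _ _ (Ideal.mem_span_singleton_self _)
    change (LinearMap.range G).mkQ ((p : R) ^ (n + 2) • x) = 0
    rw [this, map_zero]

theorem finite_level (p : ℕ) [Fact p.Prime] (R : Type) [CommRing R]
    [Algebra ℤ_[p] R] [Module.Finite ℤ_[p] R] (k : ℕ) :
    Finite (R ⧸ Ideal.span {(p : R) ^ k}) := by
  obtain ⟨n, s, hs⟩ := Module.Finite.exists_fin (R := ℤ_[p]) (M := R)
  let f : (Fin n → Fin (p ^ k)) → R ⧸ Ideal.span {(p : R) ^ k} := fun c =>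
    Ideal.Quotient.mk _ (∑ i, ((c i : ℕ) : R) * s i)
  refine Finite.of_surjective f fun y => ?_
  obtain ⟨x, rfl⟩ := Ideal.Quotient.mk_surjective y
  have hx : x ∈ Submodule.span ℤ_[p] (Set.range s) := by rw [hs]; trivial
  obtain ⟨c, rfl⟩ := (Submodule.mem_span_range_iff_exists_fun _).1 hx
  refine ⟨fun i => ⟨(c i).appr k, PadicInt.appr_lt _ _⟩, ?_⟩
  simp only [f]
  rw [eq_comm, Ideal.Quotient.mk_eq_mk_iff_sub_mem, ← Finset.sum_sub_distrib]
  refine Ideal.sum_mem _ fun i _ => ?_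
  obtain ⟨d, hd⟩ := Ideal.mem_span_singleton.1 (PadicInt.appr_spec k (c i))
  rw [Algebra.smul_def, ← sub_mul]
  refine Ideal.mul_mem_right _ _ (Ideal.mem_span_singleton.2 ⟨algebraMap _ _ d, ?_⟩)
  have := congrArg (algebraMap ℤ_[p] R) hd
  simpa using this

theorem exists_kill (p : ℕ) [Fact p.Prime] (R : Type) [CommRing R]
    [Algebra ℤ_[p] R] (M : Type) [AddCommGroup M] [Module R M] [Finite M] :
    ∃ n : ℕ, ∀ m : M, (p : R) ^ n • m = 0 := by
  have hp := (Fact.out : p.Prime)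
  obtain ⟨n, m, hm, hc⟩ := Nat.exists_eq_pow_mul_and_not_dvd (n := Nat.card M)
    (Nat.card_pos (α := M)).ne' p hp.ne_one
  refine ⟨n, fun x => ?_⟩
  have hu : IsUnit ((m : ℤ_[p])) := by
    rw [PadicInt.isUnit_iff]
    by_contra h
    have h1 : ‖((m : ℤ) : ℤ_[p])‖ < 1 := lt_of_le_of_ne (PadicInt.norm_le_one _) (by simpa using h)
    rw [PadicInt.norm_int_lt_one_iff_dvd] at h1
    exact hm (by exact_mod_cast h1)
  have hu' : IsUnit (m : R) := by simpa using hu.map (algebraMap ℤ_[p] R)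
  have h0 : (m : R) • (p : R) ^ n • x = 0 := by
    rw [← mul_smul]
    have : (m : R) * (p : R) ^ n = ((Nat.card M : ℕ) : R) := by rw [hc]; push_cast; ring
    rw [this, Nat.cast_smul_eq_nsmul, card_nsmul_eq_zero']
  exact (hu'.smul_eq_zero).1 h0

theorem statement6 (p : ℕ) [Fact p.Prime] (R : Type) [CommRing R] [IsLocalRing R]
    [Algebra ℤ_[p] R] (hinj : Function.Injective (algebraMap ℤ_[p] R))
    [Module.Finite ℤ_[p] R] [Finite (ResidueField R)]
    (N : ℕ) (hN : 1 ≤ N)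
    (M : Type) [AddCommGroup M] [Module R M] [Finite M] :
    muRN p R N M ≤ ((numAut R M : ℝ))⁻¹ := by
  obtain ⟨n, hn⟩ := exists_kill p R M
  have hfin := finite_level p R
  have hconst : ∀ j, levelProportion p R N (n + 1 + j) M = levelProportion p R N (n + 1) M := by
    intro j
    induction j with
    | zero => rfl
    | succ j ih =>
      rw [← ih]
      have h := level_succ p (R := R) N (n + j) hfin M (fun m => by
        rw [pow_add, mul_comm, mul_smul, hn, smul_zero])
      have e1 : n + 1 + (j + 1) = n + j + 2 := by omega
      have e2 : n + 1 + j = n + j + 1 := by omega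
      rw [e1, e2, h]
  have hlim : Tendsto (fun k => levelProportion p R N k M) atTop
      (nhds (levelProportion p R N (n + 1) M)) := by
    refine tendsto_const_nhds.congr' ?_
    filter_upwards [eventually_ge_atTop (n + 1)] with k hk
    obtain ⟨j, rfl⟩ := Nat.exists_eq_add_of_le hk
    exact (hconst j).symm
  unfold muRN
  rw [hlim.limUnder_eq]
  have := hfin (n + 1)
  exact level_bound (Ideal.span {(p : R) ^ (n + 1)}) N M
end

section
/- Let M be a finite R-module admitting an exact sequence R^a → R^a →^f M → 0 of R-modules. Then ker(f) ⊗_R F_R ≅ F_R^a as F_R-vector spaces; equivalently, the minimal number of generators of the R-module ker(f) is exactly a. -/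
/- STATEMENT 7: Let M be a finite R-module admitting an exact sequence
   R^a → R^a →^f M → 0 of R-modules.  Then ker(f) ⊗_R F_R ≅ F_R^a as F_R-vector
   spaces (equivalently, the minimal number of generators of ker f is exactly a). -/

open IsLocalRing

lemma aux_rank_s7 {R : Type} [CommRing R] (N : R) (hN : ¬ IsNilpotent N) (a b : ℕ)
    (H : Matrix (Fin a) (Fin b) R) (K : Matrix (Fin b) (Fin a) R)
    (h : H * K = N • (1 : Matrix (Fin a) (Fin a) R)) : a ≤ b := by
  rw [← mem_nilradical, nilradical_eq_sInf, Ideal.mem_sInf] at hN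
  push Not at hN
  obtain ⟨P, hP, hNP⟩ := hN
  have hP' : P.IsPrime := hP
  let F := FractionRing (R ⧸ P)
  let φ : R →+* F := (algebraMap (R ⧸ P) F).comp (Ideal.Quotient.mk P)
  have hφ : φ N ≠ 0 := by
    intro h0
    apply hNP
    rw [← Ideal.Quotient.eq_zero_iff_mem]
    exact (IsFractionRing.injective (R ⧸ P) F) (by simpa [φ] using h0)
  have h2 : H.map φ * K.map φ = φ N • (1 : Matrix (Fin a) (Fin a) F) := by
    rw [← Matrix.map_mul, h]
    ext i j
    by_cases hij : i = j <;> simp [Matrix.one_apply, hij]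
  have h3 : (H.map φ * K.map φ).rank = a := by
    rw [h2, Matrix.rank_of_isUnit _ ?_, Fintype.card_fin]
    rw [Matrix.isUnit_iff_isUnit_det]
    have hu := (IsUnit.mk0 _ hφ).pow a
    simp only [Matrix.det_smul, Fintype.card_fin, Matrix.det_one, mul_one]
    exact hu
  calc a = _ := h3.symm
    _ ≤ (H.map φ).rank := Matrix.rank_mul_le_left _ _
    _ ≤ b := Matrix.rank_le_width _

theorem statement7 (p : ℕ) [Fact p.Prime] (R : Type) [CommRing R] [IsLocalRing R]
    [Algebra ℤ_[p] R] (hinj : Function.Injective (algebraMap ℤ_[p] R))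
    [Module.Finite ℤ_[p] R] [Finite (ResidueField R)]
    (M : Type) [AddCommGroup M] [Module R M] [Finite M]
    (a : ℕ) (g : (Fin a → R) →ₗ[R] (Fin a → R)) (f : (Fin a → R) →ₗ[R] M)
    (hf : Function.Surjective f) (hexact : LinearMap.range g = LinearMap.ker f) :
    Nonempty ((TensorProduct R (ResidueField R) (LinearMap.ker f))
      ≃ₗ[ResidueField R] (Fin a → ResidueField R)) := by
  have hfin : Module.Finite R (LinearMap.ker f) := by
    rw [← hexact]; infer_instance
  have hup : Module.finrank (ResidueField R)
      (TensorProduct R (ResidueField R) (LinearMap.ker f)) ≤ a := by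
    rw [← hexact]
    have hs := LinearMap.lTensor_surjective (ResidueField R) (LinearMap.surjective_rangeRestrict g)
    have := LinearMap.finrank_le_finrank_of_surjective
      (f := LinearMap.baseChange (ResidueField R) g.rangeRestrict) hs
    simpa using this
  refine ⟨LinearEquiv.ofFinrankEq _ _ ?_⟩
  rw [Module.finrank_fin_fun]
  refine le_antisymm hup ?_
  let B := Module.finBasis (ResidueField R) (TensorProduct R (ResidueField R) (LinearMap.ker f))
  have hsurj : Function.Surjective (TensorProduct.mk R (ResidueField R) (LinearMap.ker f) 1) :=
    TensorProduct.mk_surjective R _ _ residue_surjective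
  choose v hv using fun i => hsurj (B i)
  have hspan : Submodule.span R (Set.range v) = ⊤ :=
    span_eq_top_of_tmul_eq_basis v B hv
  have hNnil : ¬ IsNilpotent ((Nat.card M : ℕ) : R) := by
    rintro ⟨n, hn⟩
    have : algebraMap ℤ_[p] R ((Nat.card M : ℤ_[p]) ^ n) = algebraMap ℤ_[p] R 0 := by
      simpa using hn
    have h0 := eq_zero_of_pow_eq_zero (hinj this)
    exact Nat.card_pos.ne' (Nat.cast_eq_zero.mp h0)
  have hc : ∀ j : Fin a, ∃ c : Fin _ → R,
      ∑ i, c i • (v i : Fin a → R) = ((Nat.card M : ℕ) : R) • Pi.single j 1 := by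
    intro j
    have hm : ((Nat.card M : ℕ) : R) • (Pi.single j 1 : Fin a → R) ∈ LinearMap.ker f := by
      rw [LinearMap.mem_ker, map_smul, Nat.cast_smul_eq_nsmul]
      exact card_nsmul_eq_zero'
    have ht : (⟨_, hm⟩ : LinearMap.ker f) ∈ Submodule.span R (Set.range v) := by
      rw [hspan]; trivial
    obtain ⟨c, hc⟩ := (Submodule.mem_span_range_iff_exists_fun R).1 ht
    refine ⟨c, ?_⟩
    have := congrArg (Subtype.val) hc
    simpa using this
  choose c hc using hc
  refine aux_rank_s7 _ hNnil a _ (Matrix.of fun k i => (v i : Fin a → R) k)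
    (Matrix.of fun i j => c j i) ?_
  ext k j
  have := congrFun (hc j) k
  simp only [Finset.sum_apply, Pi.smul_apply, smul_eq_mul, Pi.single_apply] at this
  simp only [Matrix.mul_apply, Matrix.of_apply, Matrix.smul_apply, Matrix.one_apply, smul_eq_mul]
  rw [← this]
  exact Finset.sum_congr rfl fun i _ => mul_comm _ _
end
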